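/- arXiv:math/0212208 — 3 statements merged into one kernel-verified Lean document; each statement's English description precedes it below -/
import Mathlib

section
/- Let k be a number field, d > 1, and f: P^N_k → P^N_k a morphism defined by homogeneous polynomials of degree d over k. Then the inverse limit of the inverse system ⋯ → P^N(k) → P^N(k) → P^N(k), with all transition maps equal to f, is finite, and its points correspond naturally to the periodic points of f in P^N(k); in particular the set of periodic points of f in P^N(k) is finite. -/
open MvPolynomial Function

noncomputable section

/-- The data of a self-morphism of `ℙ^N` over `k` of degree `d`: an `(N+1)`-tuple of
homogeneous polynomials of degree `d` with no common nontrivial zero over the algebraic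
closure of `k`. -/
structure ProjHomData (k : Type*) [Field k] (N d : ℕ) where
  F : Fin (N + 1) → MvPolynomial (Fin (N + 1)) k
  homogeneous : ∀ i, (F i).IsHomogeneous d
  no_common_zero : ∀ x : Fin (N + 1) → AlgebraicClosure k,
    (∀ i, MvPolynomial.aeval x (F i) = 0) → x = 0

namespace ProjHomData

variable {k : Type*} [Field k] {N d : ℕ}

lemma no_common_zero_base (Φ : ProjHomData k N d) (x : Fin (N + 1) → k)
    (hx : ∀ i, MvPolynomial.eval x (Φ.F i) = 0) : x = 0 := by
  have key : ∀ i, MvPolynomial.aeval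
      (fun j => algebraMap k (AlgebraicClosure k) (x j)) (Φ.F i) = 0 := by
    intro i
    have h1 := eval₂_comp_left (algebraMap k (AlgebraicClosure k)) (RingHom.id k) x (Φ.F i)
    rw [aeval_def]
    rw [show eval₂ (algebraMap k (AlgebraicClosure k))
        (fun j => algebraMap k (AlgebraicClosure k) (x j)) (Φ.F i)
      = eval₂ ((algebraMap k (AlgebraicClosure k)).comp (RingHom.id k))
        ((algebraMap k (AlgebraicClosure k)) ∘ x) (Φ.F i) by rw [RingHom.comp_id]; rfl]
    rw [← h1]
    rw [show eval₂ (RingHom.id k) x (Φ.F i) = MvPolynomial.eval x (Φ.F i) from rfl]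
    rw [hx i, map_zero]
  have h := Φ.no_common_zero _ key
  funext i
  have := congrFun h i
  exact (algebraMap k (AlgebraicClosure k)).injective (by simpa using this)

/-- The induced self-map on the `k`-points of `ℙ^N`. -/
def toFun (Φ : ProjHomData k N d) :
    Projectivization k (Fin (N + 1) → k) → Projectivization k (Fin (N + 1) → k) :=
  fun p => Projectivization.mk k (fun i => MvPolynomial.eval p.rep (Φ.F i)) (by
    intro h
    exact p.rep_nonzero (Φ.no_common_zero_base p.rep (fun i => congrFun h i)))

/-- A point is periodic for `Φ`. -/
def IsPeriodicPt (Φ : ProjHomData k N d) (p : Projectivization k (Fin (N + 1) → k)) : Prop :=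
  ∃ m : ℕ, 0 < m ∧ Φ.toFun^[m] p = p

/-- A point is preperiodic for `Φ`. -/
def IsPreperiodicPt (Φ : ProjHomData k N d) (p : Projectivization k (Fin (N + 1) → k)) : Prop :=
  ∃ m n : ℕ, n < m ∧ Φ.toFun^[m] p = Φ.toFun^[n] p

end ProjHomData

/-- The zero set in `ℙ^N(k)` of a set of (homogeneous) polynomials. -/
def projZeroSet (k : Type*) [Field k] (N : ℕ) (S : Set (MvPolynomial (Fin (N + 1)) k)) :
    Set (Projectivization k (Fin (N + 1) → k)) :=
  {p | ∀ f ∈ S, MvPolynomial.eval p.rep f = 0}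

section helpers

open Height

lemma proj_nullst {k : Type*} [Field k] {N d : ℕ} (Φ : ProjHomData k N d) :
    ∃ (M : ℕ) (q : Fin (N + 1) × Fin (N + 1) → MvPolynomial (Fin (N + 1)) k),
      (∀ a, (q a).IsHomogeneous M) ∧
      ∀ i, ∑ j, q (i, j) * Φ.F j = X i ^ (M + d) := by
  letI : GradedAlgebra (homogeneousSubmodule (Fin (N + 1)) k) := MvPolynomial.gradedAlgebra
  set I : Ideal (MvPolynomial (Fin (N + 1)) k) := Ideal.span (Set.range Φ.F) with hI
  have h1 : ∀ i, ∃ n : ℕ, (X i : MvPolynomial (Fin (N + 1)) k) ^ n ∈ I := by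
    intro i
    have : (X i : MvPolynomial (Fin (N + 1)) k) ∈ I.radical := by
      rw [← vanishingIdeal_zeroLocus_eq_radical (K := AlgebraicClosure k), hI, zeroLocus_span]
      rw [mem_vanishingIdeal_iff]
      intro x hx
      have := Φ.no_common_zero x (fun j => hx _ ⟨j, rfl⟩)
      simp [this]
    exact this
  choose n hn using h1
  set M := ∑ i, n i with hM
  have h2 : ∀ i, ∃ c : Fin (N + 1) → MvPolynomial (Fin (N + 1)) k,
      ∑ j, c j * Φ.F j = X i ^ (M + d) := by
    intro i
    have : (X i : MvPolynomial (Fin (N + 1)) k) ^ (M + d) ∈ I := by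
      have hle : n i ≤ M + d :=
        (Finset.single_le_sum (f := n) (fun _ _ => Nat.zero_le _) (Finset.mem_univ i)).trans
          (Nat.le_add_right _ _)
      exact Ideal.pow_mem_of_pow_mem I (hn i) hle
    exact (Ideal.mem_span_range_iff_exists_fun).1 this
  choose c hc using h2
  refine ⟨M, fun a => (DirectSum.decompose (homogeneousSubmodule (Fin (N + 1)) k) (c a.1 a.2) M :
    MvPolynomial (Fin (N + 1)) k), fun a => ?_, fun i => ?_⟩
  · exact (DirectSum.decompose (homogeneousSubmodule (Fin (N + 1)) k) (c a.1 a.2) M).2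
  · have hX : (X i : MvPolynomial (Fin (N + 1)) k) ^ (M + d) ∈
        homogeneousSubmodule (Fin (N + 1)) k (M + d) := by
      simpa using (isHomogeneous_X k i).pow (M + d)
    have key := DirectSum.decompose_of_mem_same _ hX
    rw [← hc i, DirectSum.decompose_sum, DFinsupp.finset_sum_apply,
      AddSubmonoidClass.coe_finset_sum] at key
    rw [hc i] at key
    rw [← key]
    refine Finset.sum_congr rfl fun j _ => ?_
    exact (DirectSum.coe_decompose_mul_add_of_right_mem
      (homogeneousSubmodule (Fin (N + 1)) k) (Φ.homogeneous j)).symm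

lemma proj_height_bound {k : Type*} [Field k] [NumberField k] {N d : ℕ}
    (Φ : ProjHomData k N d) :
    ∃ c : ℝ, ∀ p, d * Projectivization.logHeight p ≤
      Projectivization.logHeight (Φ.toFun p) + c := by
  obtain ⟨M, q, hq, h⟩ := proj_nullst Φ
  obtain ⟨C, hC⟩ := logHeight_eval_ge' (N := d) hq
  refine ⟨-C, fun p => ?_⟩
  have := hC Φ.F (x := p.rep) (fun i => by
    have := congrArg (MvPolynomial.eval p.rep) (h i)
    simpa using this)
  have h1 : Projectivization.logHeight p = Height.logHeight p.rep := by
    conv_lhs => rw [← p.mk_rep]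
    rw [Projectivization.logHeight_mk]
  have h2 : Projectivization.logHeight (Φ.toFun p) =
      Height.logHeight (fun j => MvPolynomial.eval p.rep (Φ.F j)) := by
    unfold ProjHomData.toFun
    rw [Projectivization.logHeight_mk]
  rw [h1, h2]
  linarith

lemma proj_northcott (k : Type*) [Field k] [NumberField k] (N : ℕ) (B : ℝ) :
    {p : Projectivization k (Fin (N + 1) → k) | Projectivization.logHeight p ≤ B}.Finite := by
  have hex : ∀ p : Projectivization k (Fin (N + 1) → k), ∃ i, p.rep i ≠ 0 := fun p =>
    Function.ne_iff.1 p.rep_nonzero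
  choose i hi using hex
  let φ : Projectivization k (Fin (N + 1) → k) → (Fin (N + 1) → k) :=
    fun p j => p.rep j / p.rep (i p)
  have hφ : ∀ p, φ p = (p.rep (i p))⁻¹ • p.rep := by
    intro p; funext j; simp [φ, div_eq_inv_mul]
  have hinj : Function.Injective φ := by
    intro p p' hpp
    rw [hφ, hφ] at hpp
    rw [← p.mk_rep, ← p'.mk_rep, Projectivization.mk_eq_mk_iff']
    refine ⟨p.rep (i p) * (p'.rep (i p'))⁻¹, ?_⟩
    rw [mul_smul, ← hpp, smul_smul, mul_inv_cancel₀ (hi p), one_smul]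
  have hfin : (Set.univ.pi fun _ : Fin (N + 1) => {x : k | logHeight₁ x ≤ B}).Finite :=
    Set.Finite.pi fun _ => NumberField.finite_setOfPred_logHeight₁_le k B
  refine Set.Finite.of_injOn (f := φ) ?_ hinj.injOn hfin
  intro p hp j _
  have hp' : Projectivization.logHeight p ≤ B := hp
  have h1 : Projectivization.logHeight p = Height.logHeight p.rep := by
    conv_lhs => rw [← p.mk_rep]
    rw [Projectivization.logHeight_mk]
  change logHeight₁ (p.rep j / p.rep (i p)) ≤ B
  rw [logHeight₁_div_eq_logHeight]
  have h2 := logHeight_comp_le ![j, i p] p.rep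
  have h3 : p.rep ∘ ![j, i p] = ![p.rep j, p.rep (i p)] := by
    funext t; fin_cases t <;> rfl
  rw [h3] at h2
  linarith

/-- The abstract dynamical statement. -/
lemma abstract_limit {α : Type*} (f : α → α) (h : α → ℝ) (c : ℝ)
    (hN : ∀ B : ℝ, {p | h p ≤ B}.Finite) (hf : ∀ p, 2 * h p ≤ h (f p) + c) :
    {x : ℕ → α | ∀ i : ℕ, f (x (i + 1)) = x i}.Finite ∧
    Set.BijOn (fun x => x 0) {x : ℕ → α | ∀ i : ℕ, f (x (i + 1)) = x i}
      (Function.periodicPts f) ∧ (Function.periodicPts f).Finite := by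
  have hper : (Function.periodicPts f).Finite := by
    refine (hN c).subset fun p hp => ?_
    obtain ⟨m, hm, hpm⟩ := hp
    by_contra hcon
    have hcon' : c < h p := not_le.1 hcon
    have key : ∀ n, h p + n * (h p - c) ≤ h (f^[n] p) := by
      intro n
      induction n with
      | zero => simp
      | succ n ih =>
        rw [Function.iterate_succ_apply']
        have := hf (f^[n] p)
        have h0 : 0 ≤ n * (h p - c) := mul_nonneg (Nat.cast_nonneg n) (by linarith)
        push_cast
        nlinarith
    have := key m
    rw [show f^[m] p = p from hpm] at this
    have hm' : (0 : ℝ) < m := by exact_mod_cast hm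
    nlinarith [mul_pos hm' (sub_pos.2 hcon')]
  have hit : ∀ x : ℕ → α, (∀ i, f (x (i + 1)) = x i) → ∀ n i, f^[n] (x (i + n)) = x i := by
    intro x hx n
    induction n with
    | zero => intro i; rfl
    | succ n ih =>
      intro i
      rw [Function.iterate_succ_apply, ← add_assoc, hx, ih]
  have hmem : ∀ x : ℕ → α, (∀ i, f (x (i + 1)) = x i) → ∀ i, x i ∈ Function.periodicPts f := by
    intro x hx i₀
    have hb : ∀ i, h (x i) ≤ max (h (x 0)) c := by
      intro i
      induction i with
      | zero => exact le_max_left _ _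
      | succ i ih =>
        have := hf (x (i + 1))
        rw [hx] at this
        have := le_max_right (h (x 0)) c
        linarith
    have hfin := hN (max (h (x 0)) c)
    haveI := hfin.to_subtype
    obtain ⟨a, b, hab, he⟩ := Finite.exists_ne_map_eq_of_infinite
      (fun n : ℕ => (⟨x (i₀ + n), hb (i₀ + n)⟩ : {p | h p ≤ max (h (x 0)) c}))
    have he' : x (i₀ + a) = x (i₀ + b) := congrArg Subtype.val he
    have main : ∀ a b : ℕ, a < b → x (i₀ + a) = x (i₀ + b) →
        x i₀ ∈ Function.periodicPts f := by
      intro a b hab he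
      have h1 := hit x hx (b - a) (i₀ + a)
      rw [show i₀ + a + (b - a) = i₀ + b by omega, ← he] at h1
      refine ⟨b - a, by omega, ?_⟩
      have h2 := hit x hx a i₀
      rw [← h2]
      exact Function.IsPeriodicPt.apply_iterate h1 a
    rcases lt_or_gt_of_ne hab with hlt | hlt
    · exact main a b hlt he'
    · exact main b a hlt he'.symm
  have hbij : Set.BijOn (fun x => x 0) {x : ℕ → α | ∀ i : ℕ, f (x (i + 1)) = x i}
      (Function.periodicPts f) := by
    refine ⟨fun x hx => hmem x hx 0, ?_, ?_⟩
    · intro x hx y hy hxy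
      funext n
      induction n with
      | zero => exact hxy
      | succ n ih =>
        apply (Function.bijOn_periodicPts f).injOn (hmem x hx _) (hmem y hy _)
        rw [hx, hy, ih]
    · intro p hp
      obtain ⟨m, hm, hpm⟩ := hp
      refine ⟨fun i => f^[(m - 1) * i] p, fun i => ?_, rfl⟩
      obtain ⟨m, rfl⟩ : ∃ m', m = m' + 1 := ⟨m - 1, by omega⟩
      change f (f^[m * (i + 1)] p) = f^[m * i] p
      rw [← Function.iterate_succ_apply' f, show (m * (i + 1)).succ = m * i + (m + 1) by
        rw [Nat.succ_eq_add_one]; ring, Function.iterate_add_apply, show f^[m + 1] p = p from hpm]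
  exact ⟨hbij.finite_iff_finite.2 hper, hbij, hper⟩

end helpers

/-- For a number field `k` and a morphism `f : ℙ^N_k → ℙ^N_k` of degree `d > 1`
over `k`, the inverse limit of the system `⋯ → ℙ^N(k) → ℙ^N(k)` (all transition maps `f`) is
finite and its points correspond (via `x ↦ x 0`) bijectively to the periodic points of `f`
in `ℙ^N(k)`; in particular the set of periodic points of `f` in `ℙ^N(k)` is finite. -/
theorem stmt_5 (k : Type) [Field k] [NumberField k] (N d : ℕ) (hd : 1 < d)
    (Φ : ProjHomData k N d) :
    {x : ℕ → Projectivization k (Fin (N + 1) → k) |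
        ∀ i : ℕ, Φ.toFun (x (i + 1)) = x i}.Finite ∧
    Set.BijOn (fun x => x 0)
      {x : ℕ → Projectivization k (Fin (N + 1) → k) | ∀ i : ℕ, Φ.toFun (x (i + 1)) = x i}
      {p : Projectivization k (Fin (N + 1) → k) | Φ.IsPeriodicPt p} ∧
    {p : Projectivization k (Fin (N + 1) → k) | Φ.IsPeriodicPt p}.Finite := by
  obtain ⟨c, hc⟩ := proj_height_bound Φ
  refine abstract_limit Φ.toFun Projectivization.logHeight c (proj_northcott k N) fun p => ?_
  have h0 := Projectivization.logHeight_nonneg p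
  have hd' : (2 : ℝ) ≤ d := by exact_mod_cast hd
  have := hc p
  nlinarith
end
end

section
/- Let φ: P^N → P^N be a morphism of degree d > 1 over an algebraically closed field k. Then the set of periodic points of φ in P^N(k) is Zariski dense in P^N. -/
open MvPolynomial Function

noncomputable section

lemma poly_ht {R : Type*} [CommRing R] [IsNoetherianRing R] (P : Ideal (Polynomial R)) [P.IsPrime]
    (h : ∃ f : Polynomial R, f.Monic ∧ f ∈ P) : (P.comap Polynomial.C).height + 1 ≤ P.height := by
  obtain ⟨f, hf, hfP⟩ := h
  set p := P.comap Polynomial.C with hp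
  have hpp : p.IsPrime := Ideal.comap_isPrime _ _
  have h1 : (p.map Polynomial.C).IsPrime := inferInstance
  have hle : p.map Polynomial.C ≤ P := Ideal.map_comap_le
  have hnot : f ∉ p.map Polynomial.C := by
    intro hmem
    rw [Ideal.mem_map_C_iff] at hmem
    have := hmem f.natDegree
    rw [hf.coeff_natDegree] at this
    exact hpp.ne_top ((Ideal.eq_top_iff_one _).2 this)
  have hlt : p.map Polynomial.C < P := lt_of_le_of_ne hle (fun h => hnot (h ▸ hfP))
  have hover : (p.map Polynomial.C).LiesOver p := ⟨by
    apply le_antisymm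
    · exact Ideal.le_comap_map
    · exact Ideal.comap_mono hle⟩
  have h2 : p.height ≤ (p.map Polynomial.C).height := by
    rw [Ideal.height_eq_height_add_of_liesOver_of_hasGoingDown p (p.map Polynomial.C)]
    exact le_self_add
  calc p.height + 1 ≤ (p.map Polynomial.C).height + 1 := by gcongr
    _ ≤ P.height := by
      apply Order.add_one_le_of_lt
      exact Ideal.height_strict_mono_of_isPrime hlt

lemma mv_ht (n : ℕ) : ∀ {R : Type} [CommRing R] [IsNoetherianRing R]
    (P : Ideal (MvPolynomial (Fin n) R)) [P.IsPrime],
    (∀ i, ∃ f : Polynomial R, f.Monic ∧ Polynomial.aeval (X i : MvPolynomial (Fin n) R) f ∈ P) →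
    (P.comap C).height + n ≤ P.height := by
  induction n with
  | zero =>
    intro R _ _ P _ _
    have : P.comap C = P.comap (isEmptyRingEquiv R (Fin 0)).symm := rfl
    rw [this, RingEquiv.height_comap]
    simp
  | succ n ih =>
    intro R _ _ P _ h
    let e := (finSuccEquiv R n).symm.toRingEquiv
    let P' := P.comap e
    have hP' : P'.height = P.height := RingEquiv.height_comap e P
    have : P'.IsPrime := Ideal.comap_isPrime _ _
    let P'' := P'.comap Polynomial.C
    have : P''.IsPrime := Ideal.comap_isPrime _ _
    have h1 : P''.height + 1 ≤ P'.height := by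
      apply poly_ht
      obtain ⟨f, hf, hfP⟩ := h 0
      refine ⟨f.map C, hf.map _, ?_⟩
      change (finSuccEquiv R n).symm (f.map C) ∈ P
      convert hfP
      rw [AlgEquiv.symm_apply_eq, ← Polynomial.aeval_algHom_apply (finSuccEquiv R n), finSuccEquiv_X_zero, Polynomial.aeval_def, Polynomial.eval₂_eq_sum, Polynomial.map]
      rw [Polynomial.eval₂_eq_sum]
      rfl
    have h2 := ih P'' (fun j => by
      obtain ⟨f, hf, hfP⟩ := h j.succ
      refine ⟨f, hf, ?_⟩
      change (finSuccEquiv R n).symm (Polynomial.C (Polynomial.aeval (X j) f)) ∈ P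
      convert hfP
      rw [AlgEquiv.symm_apply_eq, ← Polynomial.aeval_algHom_apply (finSuccEquiv R n), finSuccEquiv_X_succ]
      exact (Polynomial.aeval_algHom_apply (Polynomial.CAlgHom (R := R) (A := MvPolynomial (Fin n) R)) (X j) f).symm)
    have h3 : P''.comap C = P.comap C := by
      ext r
      change (finSuccEquiv R n).symm (Polynomial.C (C r)) ∈ P ↔ C r ∈ P
      have : (finSuccEquiv R n).symm (Polynomial.C (C r)) = C r := by
        rw [AlgEquiv.symm_apply_eq]; simp [finSuccEquiv_apply]
      rw [this]
    rw [h3] at h2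
    rw [← hP']
    push_cast
    rw [← add_assoc]
    exact (by gcongr : _ ≤ P''.height + 1).trans h1

lemma lift_prime {R : Type} [CommRing R] [IsNoetherianRing R] [IsDomain R] {n : ℕ}
    (f : Fin n → MvPolynomial (Fin n) R)
    (hint : ∀ i, ∃ g : Polynomial R, g.Monic ∧
      Polynomial.aeval (X i : MvPolynomial (Fin n) R) g ∈ Ideal.span (Set.range f))
    (P : Ideal (MvPolynomial (Fin n) R)) [P.IsPrime] (hP : Ideal.span (Set.range f) ≤ P) :
    ∃ q : Ideal (MvPolynomial (Fin n) R), q.IsPrime ∧ Ideal.span (Set.range f) ≤ q ∧ q ≤ P ∧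
      q.comap C = ⊥ := by
  obtain ⟨q, hq, hqP⟩ := Ideal.exists_minimalPrimes_le hP
  have hqp : q.IsPrime := hq.1.1
  refine ⟨q, hqp, hq.1.2, hqP, ?_⟩
  have h1 := Ideal.height_le_card_of_mem_minimalPrimes_span (Set.finite_range f) hq
  have h1' : (Set.range f).ncard ≤ n := by
    rw [← Set.image_univ]
    refine (Set.ncard_image_le Set.finite_univ).trans ?_
    simp
  have h2 := mv_ht n q (fun i => by
    obtain ⟨g, hg, hgm⟩ := hint i
    exact ⟨g, hg, hq.1.2 hgm⟩)
  have h3 : (q.comap C).height + n ≤ n := h2.trans (h1.trans (by exact_mod_cast h1'))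
  have h4 : (q.comap (C : R →+* MvPolynomial (Fin n) R)).height = 0 := by
    have : (q.comap (C : R →+* MvPolynomial (Fin n) R)).height + n ≤ 0 + n := by simpa using h3
    simpa using (ENat.add_le_add_iff_right (ENat.natCast_ne_top n)).1 this
  have hpr : (q.comap (C : R →+* MvPolynomial (Fin n) R)).IsPrime := Ideal.comap_isPrime _ _
  rwa [Ideal.height_eq_zero_iff, IsDomain.minimalPrimes_eq_singleton_bot, Set.mem_singleton_iff] at h4

section NF
variable {σ : Type} {k : Type} [CommRing k] (Q : ℕ) (F : σ → MvPolynomial σ k)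

open Classical in
noncomputable def nfm (hF : ∀ i, (F i).totalDegree < Q) (a : σ →₀ ℕ) : MvPolynomial σ k :=
  if h : ∃ i, Q ≤ a i then
    ∑ b ∈ (F h.choose).support.attach,
      (coeff b.1 (F h.choose)) • nfm hF (a - Finsupp.single h.choose Q + b.1)
  else monomial a 1
termination_by a.degree
decreasing_by
  have h1 : b.1.degree < Q := (le_totalDegree b.2).trans_lt (hF h.choose)
  have h2 : Finsupp.single h.choose Q ≤ a := by
    rw [Finsupp.single_le_iff]; exact h.choose_spec
  have h3 := congrArg Finsupp.degree (tsub_add_cancel_of_le h2)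
  rw [map_add, Finsupp.degree_single] at h3
  rw [map_add]; omega

noncomputable def nfL (hF : ∀ i, (F i).totalDegree < Q) : MvPolynomial σ k →ₗ[k] MvPolynomial σ k :=
  (basisMonomials σ k).constr k (nfm Q F hF)

variable {Q F} (hF : ∀ i, (F i).totalDegree < Q)
include hF

lemma nfL_monomial (a : σ →₀ ℕ) : nfL Q F hF (monomial a 1) = nfm Q F hF a := by
  have := (basisMonomials σ k).constr_basis k (nfm Q F hF) a
  rwa [coe_basisMonomials] at this

lemma nfL_sum (f : MvPolynomial σ k) : nfL Q F hF f = ∑ a ∈ f.support, coeff a f • nfm Q F hF a := by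
  conv_lhs => rw [f.as_sum]
  rw [map_sum]
  refine Finset.sum_congr rfl fun a _ => ?_
  rw [← nfL_monomial hF, ← map_smul, smul_monomial, smul_eq_mul, mul_one]

lemma nfm_small (a : σ →₀ ℕ) (h : a.degree < Q) : nfm Q F hF a = monomial a 1 := by
  rw [nfm, dif_neg]
  rintro ⟨i, hi⟩
  have := Finsupp.le_degree i a
  omega

lemma nfL_small (f : MvPolynomial σ k) (h : f.totalDegree < Q) : nfL Q F hF f = f := by
  rw [nfL_sum]
  conv_rhs => rw [f.as_sum]
  refine Finset.sum_congr rfl fun a ha => ?_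
  rw [nfm_small hF a ((le_totalDegree ha).trans_lt h), smul_monomial, smul_eq_mul, mul_one]

lemma nfm_step (a : σ →₀ ℕ) (h : ∃ i, Q ≤ a i) : ∃ i, Q ≤ a i ∧
    nfm Q F hF a = nfL Q F hF (monomial (a - Finsupp.single i Q) 1 * F i) := by
  refine ⟨h.choose, h.choose_spec, ?_⟩
  rw [nfm, dif_pos h]
  conv_rhs => rw [(F h.choose).as_sum]
  rw [Finset.mul_sum, map_sum, ← Finset.sum_attach (F h.choose).support]
  refine Finset.sum_congr rfl fun b _ => ?_
  rw [monomial_mul, one_mul, ← nfL_monomial hF, ← map_smul, smul_monomial, smul_eq_mul, mul_one]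

lemma nfL_ext (m : ℕ) (i : σ)
    (h : ∀ a : σ →₀ ℕ, a.degree < m →
      nfL Q F hF (X i ^ Q * monomial a 1) = nfL Q F hF (F i * monomial a 1))
    (g : MvPolynomial σ k) (hg : ∀ a ∈ g.support, a.degree < m) :
    nfL Q F hF (X i ^ Q * g) = nfL Q F hF (F i * g) := by
  rw [g.as_sum, Finset.mul_sum, Finset.mul_sum, map_sum, map_sum]
  refine Finset.sum_congr rfl fun a ha => ?_
  have : monomial a (coeff a g) = coeff a g • monomial a (1:k) := by
    rw [smul_monomial, smul_eq_mul, mul_one]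
  rw [this, mul_smul_comm, mul_smul_comm, map_smul, map_smul, h a (hg a ha)]

lemma nf_deg (i : σ) (a : σ →₀ ℕ) : ∀ b ∈ (F i * monomial a 1).support, b.degree < a.degree + Q := by
  classical
  intro b hb
  have := support_mul _ _ hb
  rw [Finset.mem_add] at this
  obtain ⟨c, hc, d, hd, rfl⟩ := this
  have hd' : d = a := by
    have := support_monomial_subset hd
    simpa using this
  subst hd'
  have h1 : c.degree < Q := (le_totalDegree hc).trans_lt (hF i)
  rw [map_add]; omega

lemma nfL_rel (m : ℕ) : ∀ (a : σ →₀ ℕ), a.degree < m → ∀ i,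
      nfL Q F hF (X i ^ Q * monomial a 1) = nfL Q F hF (F i * monomial a 1) := by
  induction m with
  | zero => intro a ha; omega
  | succ m ih =>
    intro a ha i
    have hX : ∀ j (b : σ →₀ ℕ), (X j : MvPolynomial σ k) ^ Q * monomial b 1
        = monomial (b + Finsupp.single j Q) 1 := by
      intro j b
      rw [X_pow_eq_monomial, monomial_mul, one_mul, add_comm]
    obtain ⟨j, hj, he⟩ := nfm_step hF (a + Finsupp.single i Q) ⟨i, by simp⟩
    rw [hX, nfL_monomial, he]
    by_cases hij : j = i
    · subst hij
      rw [add_tsub_cancel_right, mul_comm]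
    · have hj' : Q ≤ a j := by
        simpa [Finsupp.single_apply, Ne.symm hij] using hj
      have hle : Finsupp.single j Q ≤ a := by rwa [Finsupp.single_le_iff]
      obtain ⟨a', rfl⟩ := exists_add_of_le hle
      have hQ := hF i
      rw [map_add, Finsupp.degree_single] at ha
      have e1 : Finsupp.single j Q + a' + Finsupp.single i Q - Finsupp.single j Q
          = a' + Finsupp.single i Q := by rw [add_assoc, add_tsub_cancel_left]
      rw [e1, ← hX, add_comm, ← hX]
      have e2 : X i ^ Q * monomial a' 1 * F j = X i ^ Q * (F j * monomial a' 1) := by ring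
      have e3 : F i * (X j ^ Q * monomial a' 1) = X j ^ Q * (F i * monomial a' 1) := by ring
      rw [e2, e3, nfL_ext hF m i (fun a ha => ih a ha i), nfL_ext hF m j (fun a ha => ih a ha j)]
      · congr 1; ring
      · intro b hb; have := nf_deg hF i a' b hb; omega
      · intro b hb; have := nf_deg hF j a' b hb; omega

lemma nf_main (g : MvPolynomial σ k) (hg : g ∈ Ideal.span (Set.range fun i => X i ^ Q - F i))
    (hd : g.totalDegree < Q) : g = 0 := by
  rw [← nfL_small hF g hd]
  clear hd
  suffices h : ∀ c, nfL Q F hF (c * g) = 0 by simpa using h 1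
  induction hg using Submodule.span_induction with
  | mem x hx =>
    intro c
    obtain ⟨i, rfl⟩ := hx
    have := nfL_ext hF (c.totalDegree + 1) i (fun a ha => nfL_rel hF _ a ha i) c
      (fun a ha => Nat.lt_succ_of_le (le_totalDegree ha))
    have e : c * (X i ^ Q - F i) = X i ^ Q * c - F i * c := by ring
    simp only [e, map_sub, this, sub_self]
  | zero => simp
  | add x y _ _ hx hy => intro c; rw [mul_add, map_add, hx, hy, add_zero]
  | smul b x _ hx => intro c; rw [smul_eq_mul, ← mul_assoc]; exact hx _
end NF

lemma local_nilp {L : Type*} [CommRing L] [IsLocalRing L] [IsNoetherianRing L] (p : ℕ)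
    [Fact p.Prime] [CharP L p] (s D : ℕ) (e : Fin D → L)
    (hspan : ∀ x, ∃ a : Fin D → L, x = ∑ i, a i ^ (p ^ s) * e i) (hQ : D < p ^ s) :
    IsLocalRing.maximalIdeal L ^ D = ⊥ := by
  classical
  set n := IsLocalRing.maximalIdeal L with hn
  have hnak : ∀ j, n ^ j ≤ n ^ (j+1) → n ^ j = ⊥ := by
    intro j hj
    apply Submodule.eq_bot_of_le_smul_of_le_jacobson_bot n (n ^ j) (IsNoetherian.noetherian _)
    · rwa [smul_eq_mul, ← pow_succ']
    · rw [IsLocalRing.jacobson_eq_maximalIdeal _ bot_ne_top]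
  by_contra hD
  have hex : ∀ j : Fin (D+1), ∃ x, x ∈ n ^ (j:ℕ) ∧ x ∉ n ^ ((j:ℕ)+1) := by
    intro j
    by_contra! hcon
    have := hnak j hcon
    apply hD
    rw [eq_bot_iff, ← this]
    exact Ideal.pow_le_pow_right (by omega)
  choose P hP1 hP2 using hex
  choose c hc using fun j => hspan (P j)
  have hdep : ¬ LinearIndependent (IsLocalRing.ResidueField L)
      (fun j i => IsLocalRing.residue L (c j i)) := by
    intro hli
    have := hli.fintype_card_le_finrank
    simp at this
  rw [Fintype.not_linearIndependent_iff] at hdep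
  obtain ⟨g, hg, j0, hj0⟩ := hdep
  choose μ hμ using fun j => IsLocalRing.residue_surjective (g j)
  have hm : ∀ i, ∑ j, μ j * c j i ∈ n := by
    intro i
    rw [hn, ← IsLocalRing.residue_eq_zero_iff]
    have := congrFun hg i
    simpa [hμ, Finset.sum_apply] using this
  have hsum : ∑ j, μ j ^ (p^s) * P j ∈ n ^ (p^s) := by
    have : ∑ j, μ j ^ (p^s) * P j = ∑ i, (∑ j, μ j * c j i) ^ (p^s) * e i := by
      simp_rw [sum_pow_char_pow, mul_pow, Finset.sum_mul]
      rw [Finset.sum_comm]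
      refine Finset.sum_congr rfl fun j _ => ?_
      conv_lhs => rw [hc j, Finset.mul_sum]
      refine Finset.sum_congr rfl fun i _ => by ring
    rw [this]
    exact Ideal.sum_mem _ fun i _ => Ideal.mul_mem_right _ _ (Ideal.pow_mem_pow (hm i) _)
  have hne : (Finset.univ.filter fun j => g j ≠ 0).Nonempty := ⟨j0, by simp [hj0]⟩
  set j := (Finset.univ.filter fun j => g j ≠ 0).min' hne with hj
  have hgj : g j ≠ 0 := by
    have := Finset.min'_mem _ hne
    rw [Finset.mem_filter] at this; exact this.2
  have hmin : ∀ l, l < j → g l = 0 := by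
    intro l hl
    by_contra hgl
    exact absurd (Finset.min'_le _ l (by simp [hgl])) (not_le.2 hl)
  have hunit : IsUnit (μ j) := by
    by_contra hnu
    apply hgj
    rw [← hμ, IsLocalRing.residue_eq_zero_iff]
    exact hnu
  apply hP2 j
  have hrest : ∑ l ∈ Finset.univ.erase j, μ l ^ (p^s) * P l ∈ n ^ ((j:ℕ)+1) := by
    refine Ideal.sum_mem _ fun l hl => ?_
    rcases lt_trichotomy l j with h | h | h
    · have : μ l ∈ n := by
        rw [hn, ← IsLocalRing.residue_eq_zero_iff, hμ, hmin l h]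
      exact Ideal.mul_mem_right _ _ (Ideal.pow_le_pow_right (by omega) (Ideal.pow_mem_pow this (p^s)))
    · exact absurd h (Finset.ne_of_mem_erase hl)
    · exact Ideal.mul_mem_left _ _ (Ideal.pow_le_pow_right (by omega) (hP1 l))
  have h1 : μ j ^ (p^s) * P j ∈ n ^ ((j:ℕ)+1) := by
    have h2 := Ideal.pow_le_pow_right (I := n) (show (j:ℕ)+1 ≤ p^s by omega) hsum
    rw [← Finset.add_sum_erase _ _ (Finset.mem_univ j)] at h2
    exact (Ideal.add_mem_iff_left _ hrest).1 h2
  exact (Ideal.unit_mul_mem_iff_mem _ (hunit.pow _)).1 h1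

section Div
variable {n : ℕ} {R : Type} [CommRing R] {F : Fin n → MvPolynomial (Fin n) R} {d : ℕ}

attribute [local instance] MvPolynomial.gradedAlgebra in
lemma hc_mul (c f : MvPolynomial (Fin n) R) (d m : ℕ) (hf : f.IsHomogeneous d) :
    homogeneousComponent (m + d) (c * f) = homogeneousComponent m c * f := by
  rw [← decomposition.decompose'_apply, ← decomposition.decompose'_apply]
  exact DirectSum.coe_decompose_mul_add_of_right_mem (homogeneousSubmodule (Fin n) R) (i := m) (a := c) hf

lemma div1 (hF : ∀ i, (F i).IsHomogeneous d)
    (hrad : ∀ i, X i ∈ (Ideal.span (Set.range F)).radical) :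
    ∃ B, d ≤ B ∧ ∀ a : Fin n →₀ ℕ, B ≤ a.degree → ∃ c : Fin n → MvPolynomial (Fin n) R,
      (∀ j, (c j).IsHomogeneous (a.degree - d)) ∧ monomial a 1 = ∑ j, c j * F j := by
  choose E hE using hrad
  refine ⟨d + (∑ i, E i) + 1, by omega, fun a ha => ?_⟩
  have : ∃ i, E i ≤ a i := by
    by_contra! hcon
    have h1 : a.degree ≤ ∑ i, E i := by
      rw [Finsupp.degree_eq_sum]
      exact Finset.sum_le_sum fun i _ => (hcon i).le
    omega
  obtain ⟨i, hi⟩ := this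
  have hmem : (monomial a 1 : MvPolynomial (Fin n) R) ∈ Ideal.span (Set.range F) := by
    have hle : Finsupp.single i (E i) ≤ a := by rwa [Finsupp.single_le_iff]
    obtain ⟨a', rfl⟩ := exists_add_of_le hle
    have : (monomial (Finsupp.single i (E i) + a') 1 : MvPolynomial (Fin n) R)
        = X i ^ E i * monomial a' 1 := by
      rw [X_pow_eq_monomial, monomial_mul, one_mul]
    rw [this]
    exact Ideal.mul_mem_right _ _ (hE i)
  rw [Ideal.mem_span_range_iff_exists_fun] at hmem
  obtain ⟨c, hc⟩ := hmem
  refine ⟨fun j => homogeneousComponent (a.degree - d) (c j),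
    fun j => homogeneousComponent_isHomogeneous _ _, ?_⟩
  have h1 : homogeneousComponent (a.degree) (monomial a (1:R)) = monomial a 1 := by
    have : (monomial a (1:R)).IsHomogeneous a.degree := isHomogeneous_monomial _ rfl
    rw [homogeneousComponent_of_mem this, if_pos rfl]
  rw [← h1, ← hc, map_sum]
  refine Finset.sum_congr rfl fun j _ => ?_
  rw [← hc_mul _ _ d _ (hF j)]
  congr 2; omega

lemma mem_of_mon (W : Submodule R (MvPolynomial (Fin n) R)) (f : MvPolynomial (Fin n) R)
    (h : ∀ a ∈ f.support, monomial a (1:R) ∈ W) : f ∈ W := by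
  rw [f.as_sum]
  refine Submodule.sum_mem _ fun a ha => ?_
  have : monomial a (coeff a f) = coeff a f • monomial a (1:R) := by
    rw [smul_monomial, smul_eq_mul, mul_one]
  rw [this]
  exact W.smul_mem _ (h a ha)

lemma hom_deg {f : MvPolynomial (Fin n) R} {m : ℕ} (hf : f.IsHomogeneous m) {a : Fin n →₀ ℕ}
    (ha : a ∈ f.support) : a.degree = m := by
  rw [Finsupp.degree_eq_weight_one]
  exact hf (mem_support_iff.1 ha)

lemma div_int (hd : 1 < d) (hF : ∀ i, (F i).IsHomogeneous d)
    (hrad : ∀ i, X i ∈ (Ideal.span (Set.range F)).radical) (i : Fin n) :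
    ∃ g : Polynomial R, g.Monic ∧ Polynomial.aeval (X i : MvPolynomial (Fin n) R) g ∈
      Ideal.span (Set.range fun j => F j - X j) := by
  obtain ⟨B, hdB, hB⟩ := div1 hF hrad
  set I := Ideal.span (Set.range fun j => F j - X j) with hI
  let T : Set (MvPolynomial (Fin n) R) :=
    (fun a => monomial a (1:R)) '' {a : Fin n →₀ ℕ | a.degree < B}
  have hT : T.Finite := (Finsupp.finite_of_degree_lt B).image _
  let W : Submodule R (MvPolynomial (Fin n) R) := Submodule.span R T ⊔ I.restrictScalars R
  have key : ∀ m, ∀ a : Fin n →₀ ℕ, a.degree = m → monomial a (1:R) ∈ W := by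
    intro m
    induction m using Nat.strong_induction_on with
    | _ m ih =>
      intro a ha
      by_cases hlt : a.degree < B
      · exact Submodule.mem_sup_left (Submodule.subset_span ⟨a, hlt, rfl⟩)
      · obtain ⟨c, hc, he⟩ := hB a (not_lt.1 hlt)
        have : monomial a (1:R) = ∑ j, c j * X j + ∑ j, c j * (F j - X j) := by
          rw [he, ← Finset.sum_add_distrib]
          exact Finset.sum_congr rfl fun j _ => by ring
        rw [this]
        refine W.add_mem (W.sum_mem fun j _ => ?_) (Submodule.mem_sup_right ?_)
        · apply mem_of_mon
          intro b hb
          have := hom_deg ((hc j).mul (isHomogeneous_X R j)) hb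
          exact ih _ (by omega) b rfl
        · exact I.sum_mem fun j _ => I.mul_mem_left _ (Ideal.subset_span ⟨j, rfl⟩)
  have hW : W = ⊤ := by
    rw [eq_top_iff]; intro f _
    exact mem_of_mon W f fun a _ => key _ a rfl
  have hfin : Module.Finite R (MvPolynomial (Fin n) R ⧸ I) := by
    refine ⟨?_⟩
    have h1 : Submodule.map (Ideal.Quotient.mkₐ R I).toLinearMap W = ⊤ := by
      rw [hW, Submodule.map_top, LinearMap.range_eq_top]
      exact Ideal.Quotient.mkₐ_surjective R I
    have h2 : Submodule.map (Ideal.Quotient.mkₐ R I).toLinearMap (I.restrictScalars R) = ⊥ := by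
      rw [eq_bot_iff]
      rintro _ ⟨x, hx, rfl⟩
      simpa [Ideal.Quotient.eq_zero_iff_mem] using hx
    rw [← h1, Submodule.map_sup, h2, sup_bot_eq]
    exact (Submodule.fg_span hT).map _
  have hint : IsIntegral R (Ideal.Quotient.mk I (X i)) := Algebra.IsIntegral.isIntegral _
  obtain ⟨g, hg, hg0⟩ := hint
  refine ⟨g, hg, ?_⟩
  rw [← Ideal.Quotient.eq_zero_iff_mem, ← hg0]
  have := Polynomial.aeval_algHom_apply (Ideal.Quotient.mkₐ R I) (X i) g
  exact this.symm

lemma div_span (hd : 0 < d) (hF : ∀ i, (F i).IsHomogeneous d)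
    (hrad : ∀ i, X i ∈ (Ideal.span (Set.range F)).radical) :
    ∃ (D : ℕ) (e : Fin D → MvPolynomial (Fin n) R), ∀ f, ∃ g : Fin D → MvPolynomial (Fin n) R,
      f = ∑ l, bind₁ F (g l) * e l := by
  obtain ⟨B, hdB, hB⟩ := div1 hF hrad
  have hfin := Finsupp.finite_of_degree_lt (σ := Fin n) B
  let T := hfin.toFinset
  refine ⟨T.card, fun l => monomial (T.equivFin.symm l).1 1, ?_⟩
  let W : Submodule R (MvPolynomial (Fin n) R) :=
    { carrier := {f | ∃ g : Fin T.card → MvPolynomial (Fin n) R,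
        f = ∑ l, bind₁ F (g l) * monomial (T.equivFin.symm l).1 1}
      zero_mem' := ⟨0, by simp⟩
      add_mem' := by
        rintro _ _ ⟨g, rfl⟩ ⟨g', rfl⟩
        exact ⟨g + g', by simp [add_mul, Finset.sum_add_distrib]⟩
      smul_mem' := by
        rintro r _ ⟨g, rfl⟩
        exact ⟨r • g, by simp [Finset.smul_sum]⟩ }
  have hmul : ∀ j, ∀ f ∈ W, f * F j ∈ W := by
    rintro j _ ⟨g, rfl⟩
    refine ⟨fun l => g l * X j, ?_⟩
    rw [Finset.sum_mul]
    refine Finset.sum_congr rfl fun l _ => ?_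
    rw [map_mul, bind₁_X_right]; ring
  have key : ∀ m, ∀ a : Fin n →₀ ℕ, a.degree = m → monomial a (1:R) ∈ W := by
    intro m
    induction m using Nat.strong_induction_on with
    | _ m ih =>
      intro a ha
      by_cases hlt : a.degree < B
      · have haT : a ∈ T := by simpa [T] using hlt
        refine ⟨Pi.single (T.equivFin ⟨a, haT⟩) 1, ?_⟩
        rw [Finset.sum_eq_single (T.equivFin ⟨a, haT⟩)]
        · simp
        · intro b _ hb; simp [Pi.single_eq_of_ne hb]
        · simp
      · obtain ⟨c, hc, he⟩ := hB a (not_lt.1 hlt)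
        rw [he]
        refine W.sum_mem fun j _ => hmul j _ ?_
        apply mem_of_mon
        intro b hb
        have := hom_deg (hc j) hb
        exact ih _ (by omega) b rfl
  intro f
  exact mem_of_mon W f fun a _ => key _ a rfl
end Div

noncomputable def iterF {n : ℕ} {R : Type} [CommRing R] (F : Fin n → MvPolynomial (Fin n) R) :
    ℕ → Fin n → MvPolynomial (Fin n) R
  | 0 => X
  | t + 1 => fun i => bind₁ F (iterF F t i)

lemma iterF_hom {n : ℕ} {R : Type} [CommRing R] {F : Fin n → MvPolynomial (Fin n) R} {d : ℕ}
    (hF : ∀ i, (F i).IsHomogeneous d) (t : ℕ) (i : Fin n) : (iterF F t i).IsHomogeneous (d ^ t) := by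
  induction t with
  | zero => exact isHomogeneous_X R i
  | succ t ih =>
    have := ih.aeval F hF
    rw [pow_succ, mul_comm]
    exact this

lemma iterF_rad {n : ℕ} {R : Type} [CommRing R] {F : Fin n → MvPolynomial (Fin n) R}
    (hrad : ∀ i, X i ∈ (Ideal.span (Set.range F)).radical) (t : ℕ) :
    ∀ i, X i ∈ (Ideal.span (Set.range (iterF F t))).radical := by
  induction t with
  | zero => intro i; exact Ideal.le_radical (Ideal.subset_span ⟨i, rfl⟩)
  | succ t ih =>
    have h1 : ∀ i, F i ∈ (Ideal.span (Set.range (iterF F (t+1)))).radical := by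
      intro i
      obtain ⟨m, hm⟩ := ih i
      refine ⟨m, ?_⟩
      have h2 := Ideal.mem_map_of_mem (bind₁ F).toRingHom hm
      rw [Ideal.map_span, ← Set.range_comp] at h2
      have h4 : (bind₁ F).toRingHom (X i ^ m) = F i ^ m := by simp
      rw [h4] at h2
      exact h2
    intro i
    have h3 : Ideal.span (Set.range F) ≤ (Ideal.span (Set.range (iterF F (t+1)))).radical := by
      rw [Ideal.span_le]; rintro _ ⟨j, rfl⟩; exact h1 j
    have := Ideal.radical_mono h3 (hrad i)
    rwa [Ideal.radical_idem] at this

lemma iterF_map {n : ℕ} {R S : Type} [CommRing R] [CommRing S] (φ : R →+* S)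
    (F : Fin n → MvPolynomial (Fin n) R) (t : ℕ) (i : Fin n) :
    map φ (iterF F t i) = iterF (fun j => map φ (F j)) t i := by
  induction t with
  | zero => simp [iterF]
  | succ t ih => simp only [iterF]; rw [← ih, map_bind₁]

lemma expand_pow {K : Type} [Field K] [Fintype K] {n : ℕ} (s : ℕ) (g : MvPolynomial (Fin n) K) :
    bind₁ (fun i => X i ^ (Fintype.card K ^ s)) g = g ^ (Fintype.card K ^ s) := by
  obtain ⟨p, hp⟩ := CharP.exists K
  obtain ⟨r, hpr, hr⟩ := FiniteField.card K p
  have := Fact.mk hpr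
  have key : (bind₁ (fun i : Fin n => (X i : MvPolynomial (Fin n) K) ^ (Fintype.card K ^ s))).toRingHom
      = iterateFrobenius (MvPolynomial (Fin n) K) p (r * s) := by
    apply MvPolynomial.ringHom_ext
    · intro c
      simp only [AlgHom.toRingHom_eq_coe, RingHom.coe_coe, algHom_C, algebraMap_eq, iterateFrobenius_def]
      rw [pow_mul, ← hr, ← C_pow, FiniteField.pow_card_pow]
    · intro i
      simp only [AlgHom.toRingHom_eq_coe, RingHom.coe_coe, bind₁_X_right, iterateFrobenius_def]
      rw [pow_mul, ← hr]
  have := congrArg (fun φ => φ g) key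
  simp only [AlgHom.toRingHom_eq_coe, RingHom.coe_coe, iterateFrobenius_def] at this
  rw [this, pow_mul, ← hr]

lemma mk_bind {K : Type} [Field K] [Fintype K] {n : ℕ} (s : ℕ) (F : Fin n → MvPolynomial (Fin n) K)
    (I : Ideal (MvPolynomial (Fin n) K))
    (hI : ∀ i, X i ^ (Fintype.card K ^ s) - F i ∈ I) (g : MvPolynomial (Fin n) K) :
    Ideal.Quotient.mk I (bind₁ F g) = Ideal.Quotient.mk I g ^ (Fintype.card K ^ s) := by
  rw [← map_pow, ← expand_pow]
  have : (Ideal.Quotient.mkₐ K I).comp (bind₁ F) = (Ideal.Quotient.mkₐ K I).comp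
      (bind₁ (fun i => X i ^ (Fintype.card K ^ s))) := by
    apply MvPolynomial.algHom_ext
    intro i
    simp only [AlgHom.comp_apply, bind₁_X_right, Ideal.Quotient.mkₐ_eq_mk]
    exact (Ideal.Quotient.eq.2 (hI i)).symm
  exact DFunLike.congr_fun this g

lemma loc_span {A : Type} [CommRing A] (J : Ideal A) [J.IsPrime] (Q D : ℕ) (hQ : 0 < Q) (e : Fin D → A)
    (h : ∀ x : A, ∃ a : Fin D → A, x = ∑ i, a i ^ Q * e i) (x : Localization.AtPrime J) :
    ∃ a : Fin D → Localization.AtPrime J, x = ∑ i, a i ^ Q * algebraMap A _ (e i) := by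
  obtain ⟨⟨a, s⟩, hs⟩ := IsLocalization.surj J.primeCompl x
  obtain ⟨b, hb⟩ := h (a * s ^ (Q-1))
  have hu := IsLocalization.map_units (Localization.AtPrime J) s
  obtain ⟨u, hu⟩ := hu
  refine ⟨fun i => algebraMap A _ (b i) * (↑u⁻¹ : Localization.AtPrime J), ?_⟩
  have h1 := congrArg (algebraMap A (Localization.AtPrime J)) hb
  simp only [map_mul, map_sum, map_pow] at h1
  have h2 : x = (algebraMap A (Localization.AtPrime J) a * algebraMap A _ (s:A) ^ (Q-1)) * (↑u⁻¹) ^ Q := by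
    simp only at hs
    rw [← hs, ← hu, mul_assoc x, ← pow_succ', Nat.sub_add_cancel hQ, mul_assoc, ← mul_pow]
    simp
  rw [h2, h1, Finset.sum_mul]
  exact Finset.sum_congr rfl fun i _ => by ring

lemma ff {K : Type} [Field K] [Finite K] {n d : ℕ} (hd : 0 < d) {F : Fin n → MvPolynomial (Fin n) K}
    (hF : ∀ i, (F i).IsHomogeneous d)
    (hrad : ∀ i, X i ∈ (Ideal.span (Set.range F)).radical) (h : MvPolynomial (Fin n) K) (h0 : h ≠ 0) :
    ∃ t > 0, ∃ P : Ideal (MvPolynomial (Fin n) K), P.IsPrime ∧ h ∉ P ∧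
      ∀ i, iterF F t i - X i ∈ P := by
  have := Fintype.ofFinite K
  obtain ⟨p, hp⟩ := CharP.exists K
  obtain ⟨r, hpr, hr⟩ := FiniteField.card K p
  have := Fact.mk hpr
  obtain ⟨D, e, he⟩ := div_span hd hF hrad
  have hq : 1 < Fintype.card K := Fintype.one_lt_card
  obtain ⟨s, hs⟩ : ∃ s, d + D + D * h.totalDegree < Fintype.card K ^ s :=
    ⟨_, Nat.lt_pow_self hq⟩
  set Q := Fintype.card K ^ s with hQ
  have hQp : Q = p ^ (r * s) := by rw [hQ, hr, pow_mul]
  set I := Ideal.span (Set.range fun i => X i ^ Q - F i) with hI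
  have hmemI : ∀ i, X i ^ Q - F i ∈ I := fun i => Ideal.subset_span ⟨i, rfl⟩
  have hex : ∃ M : Ideal (MvPolynomial (Fin n) K), M.IsMaximal ∧ I ≤ M ∧ h ∉ M := by
    by_contra! hcon
    have hnil : (Ideal.Quotient.mk I h) ^ D = 0 := by
      apply eq_zero_of_localization
      intro J hJ
      let L := Localization.AtPrime J
      have : CharP L p := charP_of_injective_algebraMap (algebraMap K L).injective p
      have hA : ∀ x : MvPolynomial (Fin n) K ⧸ I, ∃ a : Fin D → MvPolynomial (Fin n) K ⧸ I,
          x = ∑ i, a i ^ Q * Ideal.Quotient.mk I (e i) := by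
        intro x
        obtain ⟨f, rfl⟩ := Ideal.Quotient.mk_surjective x
        obtain ⟨g, hg⟩ := he f
        refine ⟨fun l => Ideal.Quotient.mk I (g l), ?_⟩
        conv_lhs => rw [hg]
        rw [map_sum]
        refine Finset.sum_congr rfl fun l _ => ?_
        rw [map_mul, mk_bind s F I hmemI]
      have hL := loc_span J Q D (by omega) _ hA
      rw [hQp] at hL
      have hn := local_nilp (L := L) p (r * s) D _ hL (by rw [← hQp]; omega)
      have hm : algebraMap _ L (Ideal.Quotient.mk I h) ∈ IsLocalRing.maximalIdeal L := by
        rw [IsLocalization.AtPrime.to_map_mem_maximal_iff L J]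
        have hc : (J.comap (Ideal.Quotient.mk I)).IsMaximal :=
          Ideal.comap_isMaximal_of_surjective _ Ideal.Quotient.mk_surjective
        exact hcon _ hc (by
          intro x hx
          rw [Ideal.mem_comap, Ideal.Quotient.eq_zero_iff_mem.2 hx]; exact J.zero_mem)
      have := Ideal.pow_mem_pow hm D
      rw [hn, Ideal.mem_bot] at this
      rwa [map_pow]
    rw [← map_pow, Ideal.Quotient.eq_zero_iff_mem] at hnil
    have hz := nf_main (Q := Q) (F := F) (fun i => (hF i).totalDegree_le.trans_lt (by omega)) _ hnil
      ((totalDegree_pow _ _).trans_lt (by omega))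
    exact pow_ne_zero D h0 hz
  obtain ⟨M, hM, hIM, hhM⟩ := hex
  let κ := MvPolynomial (Fin n) K ⧸ M
  let _ : Field κ := Ideal.Quotient.field M
  have : Module.Finite K κ := finite_of_finite_type_of_isJacobsonRing K κ
  have : Finite κ := Module.finite_of_finite K
  have := Fintype.ofFinite κ
  have hcard : Fintype.card κ = Fintype.card K ^ Module.finrank K κ := Module.card_eq_pow_finrank
  refine ⟨Module.finrank K κ, Module.finrank_pos, M, hM.isPrime, hhM, fun i => ?_⟩
  have hit : ∀ t, Ideal.Quotient.mk M (iterF F t i) = Ideal.Quotient.mk M (X i) ^ (Q ^ t) := by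
    intro t
    induction t with
    | zero => simp [iterF]
    | succ t ih =>
      simp only [iterF]
      rw [mk_bind s F M (fun i => hIM (hmemI i)), ih, ← pow_mul, ← hQ, pow_succ]
  rw [← Ideal.Quotient.eq_zero_iff_mem, map_sub, hit, hQ, ← pow_mul, mul_comm s, pow_mul, ← hcard, sub_eq_zero]
  exact FiniteField.pow_card_pow (K := κ) s _

lemma jacZ : IsJacobsonRing ℤ := by
  rw [isJacobsonRing_iff_prime_eq]
  intro P hP
  by_cases h : P = ⊥
  · subst h
    rw [eq_bot_iff]
    intro x hx
    rw [Ideal.mem_jacobson_bot] at hx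
    have h1 := Int.isUnit_iff.1 (hx x)
    rw [Ideal.mem_bot]
    rcases h1 with h1 | h1 <;> nlinarith
  · have := IsPrime.to_maximal_ideal h
    exact Ideal.jacobson_eq_self_of_isMaximal

lemma finK {K : Type} [CommRing K] (hK : IsField K) [Algebra.FiniteType ℤ K] : Finite K := by
  let _ := hK.toField
  have := jacZ
  have h1 : Module.Finite ℤ K := finite_of_finite_type_of_isJacobsonRing ℤ K
  have h2 : ¬ Function.Injective (algebraMap ℤ K) := by
    intro hi
    exact Int.not_isField (isField_of_isIntegral_of_isField hi hK)
  rw [injective_iff_map_eq_zero] at h2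
  push Not at h2
  obtain ⟨a, ha, ha0⟩ := h2
  apply Module.finite_of_fg_torsion
  intro x
  refine ⟨⟨a, mem_nonZeroDivisors_of_ne_zero ha0⟩, ?_⟩
  change a • x = 0
  rw [Algebra.smul_def, ha, zero_mul]

lemma rad_map {R S : Type} [CommRing R] [CommRing S] (φ : R →+* S) {n : ℕ}
    {F : Fin n → MvPolynomial (Fin n) R}
    (hrad : ∀ i, X i ∈ (Ideal.span (Set.range F)).radical) (i : Fin n) :
    (X i : MvPolynomial (Fin n) S) ∈ (Ideal.span (Set.range fun j => map φ (F j))).radical := by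
  obtain ⟨m, hm⟩ := hrad i
  refine ⟨m, ?_⟩
  have := Ideal.mem_map_of_mem (map φ) hm
  rw [Ideal.map_span, ← Set.range_comp] at this
  rw [map_pow, map_X] at this
  exact this

lemma over_R {R k : Type} [CommRing R] [IsDomain R] [Algebra.FiniteType ℤ R] [Field k]
    [IsAlgClosed k] [Algebra R k] (hinj : Function.Injective (algebraMap R k)) {n d : ℕ} (hd : 1 < d)
    {F : Fin n → MvPolynomial (Fin n) R} (hF : ∀ i, (F i).IsHomogeneous d)
    (hrad : ∀ i, X i ∈ (Ideal.span (Set.range F)).radical) (h : MvPolynomial (Fin n) R) (h0 : h ≠ 0) :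
    ∃ t > 0, ∃ w : Fin n → k, (∀ i, aeval w (iterF F t i) = w i) ∧ aeval w h ≠ 0 := by
  have : IsNoetherianRing R := Algebra.FiniteType.isNoetherianRing ℤ R
  have := jacZ
  have : IsJacobsonRing R := isJacobsonRing_of_finiteType (A := ℤ)
  obtain ⟨a, ha⟩ : ∃ a, coeff a h ≠ 0 := by
    by_contra! hc
    exact h0 (MvPolynomial.ext _ _ fun a => by simp [hc a])
  obtain ⟨m, hm, hcm⟩ : ∃ m : Ideal R, m.IsMaximal ∧ coeff a h ∉ m := by
    by_contra! hc
    have h1 : coeff a h ∈ (⊥ : Ideal R).jacobson := by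
      rw [Ideal.jacobson, Ideal.mem_sInf]
      rintro I ⟨_, hI⟩
      exact hc I hI
    rw [← Ideal.radical_eq_jacobson] at h1
    obtain ⟨j, hj⟩ := h1
    exact ha (eq_zero_of_pow_eq_zero (by simpa using hj))
  let K := R ⧸ m
  have : @Algebra.FiniteType ℤ K _ _ (Ring.toIntAlgebra K) :=
    @Algebra.FiniteType.of_surjective ℤ R K _ _ _ _ (Ring.toIntAlgebra K) _
      (RingHom.toIntAlgHom (Ideal.Quotient.mk m)) Ideal.Quotient.mk_surjective
  have : Finite K := finK ((Ideal.Quotient.maximal_ideal_iff_isField_quotient m).1 hm)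
  let _ : Field K := Ideal.Quotient.field m
  let φ : R →+* K := Ideal.Quotient.mk m
  have hb0 : map φ h ≠ 0 := by
    intro hz
    apply hcm
    rw [← Ideal.Quotient.eq_zero_iff_mem]
    have := congrArg (coeff a) hz
    rwa [coeff_map, coeff_zero] at this
  obtain ⟨t, ht, P', hP', hhP', hFP'⟩ := ff (K := K) (by omega : 0 < d) (fun i => (hF i).map φ)
    (rad_map φ hrad) (map φ h) hb0
  let P := P'.comap (map φ)
  have hP : P.IsPrime := Ideal.comap_isPrime _ _
  have hle : Ideal.span (Set.range fun j => iterF F t j - X j) ≤ P := by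
    rw [Ideal.span_le]
    rintro _ ⟨j, rfl⟩
    change map φ _ ∈ P'
    rw [map_sub, iterF_map, map_X]
    exact hFP' j
  obtain ⟨q, hq, hle', hqP, hqC⟩ := lift_prime (fun j => iterF F t j - X j)
    (div_int (Nat.one_lt_pow (by omega) hd) (iterF_hom hF t) (iterF_rad hrad t)) P hle
  let S := MvPolynomial (Fin n) R ⧸ q
  have hint : ∀ i, IsIntegral R (Ideal.Quotient.mk q (X i)) := by
    intro i
    obtain ⟨g, hg, hg'⟩ := div_int (Nat.one_lt_pow (by omega) hd) (iterF_hom hF t) (iterF_rad hrad t) i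
    refine ⟨g, hg, ?_⟩
    have := Ideal.Quotient.eq_zero_iff_mem.2 (hle' hg')
    rw [← this, ← Polynomial.aeval_def]
    exact Polynomial.aeval_algHom_apply (Ideal.Quotient.mkₐ R q) (X i) g
  have : Algebra.IsIntegral R S := by
    constructor
    intro x
    obtain ⟨f, rfl⟩ := Ideal.Quotient.mk_surjective x
    induction f using MvPolynomial.induction_on with
    | C a => exact isIntegral_algebraMap (R := R) (A := S) (x := a)
    | add p q hp hq => rw [map_add]; exact hp.add hq
    | mul_X p i hp => rw [map_mul]; exact hp.mul (hint i)
  have hS : Function.Injective (algebraMap R S) := by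
    rw [injective_iff_map_eq_zero]
    intro a ha
    have : C a ∈ q := Ideal.Quotient.eq_zero_iff_mem.1 ha
    rw [← Ideal.mem_comap] at this
    rw [hqC] at this
    exact this
  have : FaithfulSMul R S := (faithfulSMul_iff_algebraMap_injective R S).2 hS
  have : FaithfulSMul R k := (faithfulSMul_iff_algebraMap_injective R k).2 hinj
  have : Module.IsTorsionFree R S := inferInstance
  have : Module.IsTorsionFree R k := inferInstance
  let ψ : S →ₐ[R] k := IsAlgClosed.lift
  have hker : RingHom.ker (ψ : S →+* k) = ⊥ := by
    apply Ideal.eq_bot_of_comap_eq_bot (R := R)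
    rw [eq_bot_iff]
    intro a ha
    have : ψ (algebraMap R S a) = 0 := ha
    rw [ψ.commutes] at this
    exact (injective_iff_map_eq_zero _).1 hinj a this
  have hcomp : ∀ f, aeval (fun i => ψ (Ideal.Quotient.mk q (X i))) f = ψ (Ideal.Quotient.mk q f) := by
    intro f
    have : aeval (fun i => ψ (Ideal.Quotient.mk q (X i))) = ψ.comp (Ideal.Quotient.mkₐ R q) := by
      ext i; rw [aeval_X]; rfl
    rw [this]; rfl
  refine ⟨t, ht, fun i => ψ (Ideal.Quotient.mk q (X i)), fun i => ?_, ?_⟩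
  · rw [hcomp]
    congr 1
    rw [Ideal.Quotient.eq]
    exact hle' (Ideal.subset_span ⟨i, rfl⟩)
  · rw [hcomp]
    intro hz
    have : Ideal.Quotient.mk q h ∈ RingHom.ker (ψ : S →+* k) := hz
    rw [hker, Ideal.mem_bot, Ideal.Quotient.eq_zero_iff_mem] at this
    exact hhP' (hqP this)

lemma over_k {k : Type} [Field k] [IsAlgClosed k] {n d : ℕ} (hd : 1 < d)
    {F : Fin n → MvPolynomial (Fin n) k} (hF : ∀ i, (F i).IsHomogeneous d)
    (hrad : ∀ i, X i ∈ (Ideal.span (Set.range F)).radical) (h : MvPolynomial (Fin n) k) (h0 : h ≠ 0) :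
    ∃ t > 0, ∃ w : Fin n → k, (∀ i, eval w (iterF F t i) = w i) ∧ eval w h ≠ 0 := by
  choose E hE using hrad
  have hE' : ∀ i, ∃ c : Fin n → MvPolynomial (Fin n) k, ∑ j, c j * F j = X i ^ E i := fun i =>
    Ideal.mem_span_range_iff_exists_fun.1 (hE i)
  choose c hc using hE'
  let T : Set k := (h.coeffs : Set k) ∪ (⋃ i, ((F i).coeffs : Set k)) ∪
    ⋃ i, ⋃ j, ((c i j).coeffs : Set k)
  have hT : T.Finite := ((Finset.finite_toSet _).union
    (Set.finite_iUnion fun i => Finset.finite_toSet _)).union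
    (Set.finite_iUnion fun i => Set.finite_iUnion fun j => Finset.finite_toSet _)
  let R := Algebra.adjoin ℤ T
  have hft : Algebra.FiniteType ℤ R := Algebra.FiniteType.adjoin_of_finite hT
  have hft' : @Algebra.FiniteType ℤ R _ _ (Ring.toIntAlgebra R) := by
    convert hft
  let ι : R →+* k := algebraMap R k
  have hι : Function.Injective ι := Subtype.val_injective
  have hl : ∀ f : MvPolynomial (Fin n) k, (f.coeffs : Set k) ⊆ T → ∃ g : MvPolynomial (Fin n) R, map ι g = f := by
    intro f hf
    have : f ∈ Set.range (map ι) := by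
      rw [mem_range_map_iff_coeffs_subset]
      intro x hx
      exact ⟨⟨x, Algebra.subset_adjoin (hf hx)⟩, rfl⟩
    exact this
  obtain ⟨h', hh'⟩ := hl h (fun x hx => Or.inl (Or.inl hx))
  have hF' : ∀ i, ∃ g, map ι g = F i := fun i =>
    hl _ (fun x hx => Or.inl (Or.inr (Set.mem_iUnion.2 ⟨i, hx⟩)))
  have hc' : ∀ i j, ∃ g, map ι g = c i j := fun i j =>
    hl _ (fun x hx => Or.inr (Set.mem_iUnion.2 ⟨i, Set.mem_iUnion.2 ⟨j, hx⟩⟩))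
  choose F' hF' using hF'
  choose c' hc' using hc'
  have hmi := MvPolynomial.map_injective (σ := Fin n) ι hι
  have hR := @over_R R k _ _ hft' _ _ _ hι n d hd F'
    (fun i => IsHomogeneous.of_map hι (by rw [hF']; exact hF i))
    (fun i => ⟨E i, by
      rw [Ideal.mem_span_range_iff_exists_fun]
      refine ⟨c' i, hmi ?_⟩
      rw [map_sum, map_pow, map_X, ← hc i]
      exact Finset.sum_congr rfl fun j _ => by rw [map_mul, hF', hc']⟩) h'
    (by rintro rfl; exact h0 (by rw [← hh', map_zero]))
  obtain ⟨t, ht, w, hw, hwh⟩ := hR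
  have hev : ∀ g : MvPolynomial (Fin n) R, aeval w g = eval w (map ι g) := by
    intro g
    rw [eval_map]; rfl
  refine ⟨t, ht, w, fun i => ?_, ?_⟩
  · have := hw i
    rw [hev, iterF_map] at this
    simpa only [hF'] using this
  · rwa [hev, hh'] at hwh

lemma eval_hom {k : Type} [Field k] {n e : ℕ} {f : MvPolynomial (Fin n) k} (hf : f.IsHomogeneous e)
    (a : k) (w : Fin n → k) : eval (a • w) f = a ^ e * eval w f := by
  rw [eval_eq, eval_eq, Finset.mul_sum]
  refine Finset.sum_congr rfl fun b hb => ?_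
  have h1 : b.degree = e := by
    rw [← hf (mem_support_iff.1 hb), Finsupp.degree_eq_weight_one]; rfl
  have h2 : ∏ i ∈ b.support, (a • w) i ^ b i = a ^ e * ∏ i ∈ b.support, w i ^ b i := by
    simp only [Pi.smul_apply, smul_eq_mul, mul_pow]
    rw [Finset.prod_mul_distrib, Finset.prod_pow_eq_pow_sum, ← h1]
    rfl
  rw [h2]; ring

lemma toFun_mk {k : Type} [Field k] {N d : ℕ} (Φ : ProjHomData k N d) (w : Fin (N + 1) → k) (hw : w ≠ 0)
    (hw' : (fun i => eval w (Φ.F i)) ≠ 0) :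
    Φ.toFun (Projectivization.mk k w hw) = Projectivization.mk k (fun i => eval w (Φ.F i)) hw' := by
  unfold ProjHomData.toFun
  rw [Projectivization.mk_eq_mk_iff']
  obtain ⟨a, ha⟩ := Projectivization.exists_smul_eq_mk_rep k w hw
  refine ⟨(a : k) ^ d, ?_⟩
  funext i
  rw [← ha]
  exact (eval_hom (Φ.homogeneous i) (a : k) w).symm

lemma eval_iter {k : Type} [Field k] {n : ℕ} (F : Fin n → MvPolynomial (Fin n) k) (w : Fin n → k) (t : ℕ)
    (i : Fin n) : eval w (iterF F (t + 1) i) = eval (fun j => eval w (F j)) (iterF F t i) := by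
  change eval w (bind₁ F (iterF F t i)) = _
  rw [← coe_aeval_eq_eval, ← coe_aeval_eq_eval]
  exact aeval_bind₁ _ _ _

lemma toFun_iter {k : Type} [Field k] {N d : ℕ} (Φ : ProjHomData k N d) (t : ℕ) :
    ∀ (w : Fin (N + 1) → k) (hw : w ≠ 0), ∃ hw' : (fun i => eval w (iterF Φ.F t i)) ≠ 0,
    Φ.toFun^[t] (Projectivization.mk k w hw) =
      Projectivization.mk k (fun i => eval w (iterF Φ.F t i)) hw' := by
  induction t with
  | zero =>
    intro w hw
    have h1 : (fun i => eval w (iterF Φ.F 0 i)) = w := by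
      funext i; simp [iterF]
    refine ⟨by rw [h1]; exact hw, ?_⟩
    simp only [h1]; rfl
  | succ t ih =>
    intro w hw
    have h2 : (fun i => eval w (Φ.F i)) ≠ 0 := fun h => hw (Φ.no_common_zero_base w fun i => congrFun h i)
    obtain ⟨h3, h4⟩ := ih _ h2
    have h5 : (fun i => eval w (iterF Φ.F (t + 1) i)) =
        fun i => eval (fun j => eval w (Φ.F j)) (iterF Φ.F t i) := by
      funext i; exact eval_iter _ _ _ _
    refine ⟨by rw [h5]; exact h3, ?_⟩
    rw [Function.iterate_succ_apply, toFun_mk Φ w hw h2, h4]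
    simp only [h5]

lemma rad_k {k : Type} [Field k] [IsAlgClosed k] {N d : ℕ} (Φ : ProjHomData k N d) (i : Fin (N + 1)) :
    X i ∈ (Ideal.span (Set.range Φ.F)).radical := by
  rw [← vanishingIdeal_zeroLocus_eq_radical (K := k), mem_vanishingIdeal_iff]
  intro x hx
  have h1 : x = 0 := by
    apply Φ.no_common_zero_base
    intro j
    exact hx _ (Ideal.subset_span ⟨j, rfl⟩)
  simp [h1]

/-- For a morphism `φ : ℙ^N → ℙ^N` of degree `d > 1` over an algebraically
closed field `k`, the set of periodic points of `φ` in `ℙ^N(k)` is Zariski dense in `ℙ^N`: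
the only Zariski closed subset (i.e. zero set of a set of homogeneous forms) containing all
periodic points is all of `ℙ^N`. -/
theorem stmt_16 (k : Type) [Field k] [IsAlgClosed k] (N d : ℕ) (hd : 1 < d)
    (Φ : ProjHomData k N d) :
    ∀ S : Set (MvPolynomial (Fin (N + 1)) k),
      (∀ f ∈ S, ∃ e : ℕ, f.IsHomogeneous e) →
      {p : Projectivization k (Fin (N + 1) → k) | Φ.IsPeriodicPt p} ⊆ projZeroSet k N S →
      projZeroSet k N S = Set.univ := by
  intro S hS hper
  rw [Set.eq_univ_iff_forall]
  intro p f hf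
  by_contra hne
  obtain ⟨e, he⟩ := hS f hf
  have hf0 : f ≠ 0 := by
    rintro rfl
    exact hne (map_zero _)
  obtain ⟨t, ht, w, hw, hwh⟩ := over_k hd Φ.homogeneous (rad_k Φ) (f * X 0)
    (mul_ne_zero hf0 (X_ne_zero 0))
  rw [map_mul, eval_X] at hwh
  have hw0 : w ≠ 0 := by
    rintro rfl
    exact hwh (by simp)
  obtain ⟨h1, h2⟩ := toFun_iter Φ t w hw0
  have h3 : (fun i => eval w (iterF Φ.F t i)) = w := funext hw
  simp only [h3] at h2
  have h4 := hper (show Φ.IsPeriodicPt _ from ⟨t, ht, h2⟩) f hf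
  obtain ⟨a, ha⟩ := Projectivization.exists_smul_eq_mk_rep k w hw0
  rw [← ha] at h4
  have h5 := eval_hom he (a : k) w
  have h6 : (a : k) ^ e * eval w f = 0 := by rw [← h5]; exact h4
  rcases mul_eq_zero.1 h6 with h7 | h7
  · exact a.ne_zero (eq_zero_of_pow_eq_zero h7)
  · exact hwh (by rw [h7, zero_mul])
end
end

section
/- Let F be the algebraic closure of a finite field, X an algebraic variety over F, and φ: X → X a finite surjective morphism. Then the set of points of X(F) that are periodic for φ is Zariski dense in X. -/
open AlgebraicGeometry CategoryTheory CategoryTheory.Limits Opposite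

noncomputable section

universe u

/-- The `n`-th iterate of a self-morphism of a scheme. -/
def morphIter {X : Scheme.{u}} (φ : X ⟶ X) : ℕ → (X ⟶ X) :=
  Nat.rec (𝟙 X) (fun _ g => g ≫ φ)

namespace PerDense

section filt
variable {k S : Type*} [Field k] [CommRing S] [Algebra k S] {N : ℕ}

def mon (y : Fin N → S) (a : Fin N → ℕ) : S := ∏ j, y j ^ a j

lemma mon_add (y : Fin N → S) (a b : Fin N → ℕ) : mon y (a + b) = mon y a * mon y b := by
  simp [mon, pow_add, Finset.prod_mul_distrib]

lemma mon_nsmul (y : Fin N → S) (n : ℕ) (a : Fin N → ℕ) :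
    mon y (fun j => n * a j) = mon y a ^ n := by
  simp only [mon, ← Finset.prod_pow]
  refine Finset.prod_congr rfl fun j _ => ?_
  rw [mul_comm, pow_mul]

variable (k) in
def filt (y : Fin N → S) (t : ℕ) : Submodule k S :=
  Submodule.span k (mon y '' {a | ∑ j, a j ≤ t})

lemma mon_mem (y : Fin N → S) {t : ℕ} {a : Fin N → ℕ} (h : ∑ j, a j ≤ t) :
    mon y a ∈ filt k y t := Submodule.subset_span ⟨a, h, rfl⟩

lemma filt_induct (y : Fin N → S) (t : ℕ) (W : Submodule k S)
    (h : ∀ a : Fin N → ℕ, ∑ j, a j ≤ t → mon y a ∈ W) : filt k y t ≤ W := by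
  rw [filt, Submodule.span_le]
  rintro _ ⟨a, ha, rfl⟩
  exact h a ha

lemma filt_mono (y : Fin N → S) : Monotone (filt k y) := by
  intro s t h
  exact filt_induct y s _ fun a ha => mon_mem y (ha.trans h)

lemma filt_map (y : Fin N → S) (t : ℕ) (W : Submodule k S) (f : S →ₗ[k] S)
    (h : ∀ a : Fin N → ℕ, ∑ j, a j ≤ t → f (mon y a) ∈ W) {x : S} (hx : x ∈ filt k y t) :
    f x ∈ W :=
  filt_induct y t (W.comap f) h hx

lemma filt_mul (y : Fin N → S) {s t : ℕ} {a b : S} (ha : a ∈ filt k y s) (hb : b ∈ filt k y t) :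
    a * b ∈ filt k y (s + t) := by
  refine filt_map y t _ (LinearMap.mulLeft k a) (fun β hβ => ?_) hb
  refine filt_map y s _ (LinearMap.mulRight k (mon y β)) (fun α hα => ?_) ha
  simp only [LinearMap.mulRight_apply]
  rw [← mon_add]
  apply mon_mem
  simp only [Pi.add_apply, Finset.sum_add_distrib]
  omega

lemma filt_one (y : Fin N → S) (t : ℕ) : (1 : S) ∈ filt k y t := by
  have : mon y (0 : Fin N → ℕ) ∈ filt k y t := mon_mem y (by simp)
  simpa [mon] using this

lemma filt_gen (y : Fin N → S) (j : Fin N) : y j ∈ filt k y 1 := by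
  have : mon y (Pi.single j 1) ∈ filt k y 1 := mon_mem y (by simp)
  convert this
  simp only [mon]
  rw [Finset.prod_eq_single j]
  · simp
  · intro b _ hb; simp [hb]
  · simp

instance filt_fin (y : Fin N → S) (t : ℕ) : FiniteDimensional k (filt k y t) := by
  apply FiniteDimensional.span_of_finite
  apply Set.Finite.image
  refine (Set.finite_Iic (fun _ : Fin N => t)).subset ?_
  intro a ha j
  exact (Finset.single_le_sum (f := a) (fun _ _ => Nat.zero_le _) (Finset.mem_univ j)).trans ha

lemma filt_exh (y : Fin N → S) (hy : Algebra.adjoin k (Set.range y) = ⊤) (x : S) :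
    ∃ t, x ∈ filt k y t := by
  have hx : x ∈ Algebra.adjoin k (Set.range y) := hy ▸ Algebra.mem_top
  induction hx using Algebra.adjoin_induction with
  | mem x hx => obtain ⟨j, rfl⟩ := hx; exact ⟨1, filt_gen y j⟩
  | algebraMap r => 
    refine ⟨0, ?_⟩
    rw [Algebra.algebraMap_eq_smul_one]
    exact Submodule.smul_mem _ _ (filt_one y 0)
  | add a b _ _ ha hb =>
    obtain ⟨s, hs⟩ := ha
    obtain ⟨t, ht⟩ := hb
    exact ⟨s + t, add_mem (filt_mono y (by omega) hs) (filt_mono y (by omega) ht)⟩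
  | mul a b _ _ ha hb =>
    obtain ⟨s, hs⟩ := ha
    obtain ⟨t, ht⟩ := hb
    exact ⟨s + t, filt_mul y hs ht⟩

lemma filt_exh_fam (y : Fin N → S) (hy : Algebra.adjoin k (Set.range y) = ⊤) {ι : Type*} [Finite ι]
    (x : ι → S) : ∃ t, ∀ i, x i ∈ filt k y t := by
  choose t ht using fun i => filt_exh (k := k) y hy (x i)
  obtain ⟨B, hB⟩ := (Set.finite_range t).bddAbove
  exact ⟨B, fun i => filt_mono y (hB ⟨i, rfl⟩) (ht i)⟩

lemma filt_pow (y : Fin N → S) {s : ℕ} {a : S} (ha : a ∈ filt k y s) (n : ℕ) :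
    a ^ n ∈ filt k y (s * n) := by
  induction n with
  | zero => simpa using filt_one y 0
  | succ n ih => rw [pow_succ, mul_add, mul_one]; exact filt_mul y ih ha

lemma filt_prod (y : Fin N → S) {ι : Type*} (s : Finset ι) (f : ι → S) (d : ι → ℕ)
    (h : ∀ i ∈ s, f i ∈ filt k y (d i)) : ∏ i ∈ s, f i ∈ filt k y (∑ i ∈ s, d i) := by
  classical
  induction s using Finset.induction_on with
  | empty => simpa using filt_one y 0
  | insert i s hi ih =>
    rw [Finset.prod_insert hi, Finset.sum_insert hi]
    exact filt_mul y (h i (by simp)) (ih fun j hj => h j (by simp [hj]))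

lemma filt_hom (y : Fin N → S) (Φ : S →ₐ[k] S) {δ : ℕ} (hδ : ∀ j, Φ (y j) ∈ filt k y δ)
    {t : ℕ} {x : S} (hx : x ∈ filt k y t) : Φ x ∈ filt k y (δ * t) := by
  refine filt_map y t _ Φ.toLinearMap (fun a ha => ?_) hx
  simp only [AlgHom.toLinearMap_apply, mon, map_prod, map_pow]
  have := filt_prod (k := k) y Finset.univ (fun j => Φ (y j) ^ a j) (fun j => δ * a j)
    (fun j _ => filt_pow y (hδ j) _)
  refine filt_mono y ?_ this
  rw [← Finset.mul_sum]
  exact Nat.mul_le_mul_left _ ha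

/-- partial trace -/
def prj (p : Submodule k S) : S →ₗ[k] p :=
  (LinearMap.exists_leftInverse_of_injective p.subtype p.ker_subtype).choose

lemma prj_spec (p : Submodule k S) (x : S) (hx : x ∈ p) : prj p x = ⟨x, hx⟩ := by
  have := (LinearMap.exists_leftInverse_of_injective p.subtype p.ker_subtype).choose_spec
  exact LinearMap.congr_fun this ⟨x, hx⟩

def ptr (p : Submodule k S) : (S →ₗ[k] S) →ₗ[k] k where
  toFun f := LinearMap.trace k p (prj p ∘ₗ f ∘ₗ p.subtype)
  map_add' f g := by simp [LinearMap.add_comp, LinearMap.comp_add]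
  map_smul' c f := by simp [LinearMap.smul_comp, LinearMap.comp_smul]

lemma ptr_comm (p p' : Submodule k S) [FiniteDimensional k p] [FiniteDimensional k p']
    (f g : S →ₗ[k] S) (hf : ∀ x ∈ p, f x ∈ p') (hg : ∀ x ∈ p', g x ∈ p) :
    ptr p (g ∘ₗ f) = ptr p' (f ∘ₗ g) := by
  have h1 : prj p ∘ₗ (g ∘ₗ f) ∘ₗ p.subtype =
      (prj p ∘ₗ g ∘ₗ p'.subtype) ∘ₗ (prj p' ∘ₗ f ∘ₗ p.subtype) := by
    ext x
    simp [prj_spec p' _ (hf x x.2)]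
  have h2 : prj p' ∘ₗ (f ∘ₗ g) ∘ₗ p'.subtype =
      (prj p' ∘ₗ f ∘ₗ p.subtype) ∘ₗ (prj p ∘ₗ g ∘ₗ p'.subtype) := by
    ext x
    simp [prj_spec p _ (hg x x.2)]
  simp only [ptr, LinearMap.coe_mk, AddHom.coe_mk]
  rw [h1, h2, LinearMap.trace_comp_comm']

lemma ptr_le {p p' : Submodule k S} [FiniteDimensional k p] [FiniteDimensional k p']
    (hp : p ≤ p') (f : S →ₗ[k] S) (hf : ∀ x ∈ p', f x ∈ p) : ptr p f = ptr p' f := by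
  simpa using ptr_comm p p' LinearMap.id f (fun x hx => hp hx) hf

lemma ptr_line (h : S) (h0 : h ≠ 0) (f : S →ₗ[k] S) (hf : f h = h) :
    ptr (Submodule.span k {h}) f = 1 := by
  have : prj (Submodule.span k {h}) ∘ₗ f ∘ₗ (Submodule.span k {h}).subtype = LinearMap.id := by
    ext ⟨x, hx⟩
    obtain ⟨c, rfl⟩ := Submodule.mem_span_singleton.1 hx
    simp [hf, prj_spec _ h (Submodule.mem_span_singleton_self h)]
  simp only [ptr, LinearMap.coe_mk, AddHom.coe_mk]
  rw [this, LinearMap.trace_id, finrank_span_singleton h0]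
  simp

end filt
end PerDense

namespace PerDense

section frob
variable {k : Type*} [Field k] [Fintype k]

/-- a Frobenius-inverse linear functional on a field -/
lemma exists_lam (K : Type*) [Field K] [Algebra k K] : ∃ f : K →ₗ[k] K,
    (∀ a b, f (a ^ Fintype.card k * b) = a * f b) ∧ f 1 = 1 := by
  let F : K →ₐ[k] K := FiniteField.frobeniusAlgHom k K
  have hF : ∀ x, F x = x ^ Fintype.card k := fun x => rfl
  let L := F.fieldRange
  obtain ⟨g, hg⟩ := LinearMap.exists_leftInverse_of_injective (Algebra.linearMap L K)
    (LinearMap.ker_eq_bot.2 (algebraMap L K).injective)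
  let e : K ≃ₐ[k] F.range := AlgEquiv.ofInjectiveField F
  have he : ∀ z : L, F (e.symm z) = (z : K) := by
    intro z
    have := congrArg Subtype.val (e.apply_symm_apply z)
    exact this
  have hinj : Function.Injective F := F.toRingHom.injective
  have key : ∀ a b : K, g (F a * b) = (⟨F a, ⟨a, rfl⟩⟩ : L) * g b := by
    intro a b
    have := g.map_smul (⟨F a, ⟨a, rfl⟩⟩ : L) b
    simpa [Algebra.smul_def] using this
  have hk : ∀ c : k, F (algebraMap k K c) = algebraMap k K c := fun c => F.commutes c
  let f0 : K → K := fun x => e.symm (g x : F.range)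
  have hf0 : ∀ x, F (f0 x) = (g x : K) := fun x => he (g x)
  have hmul : ∀ a b, f0 (a ^ Fintype.card k * b) = a * f0 b := by
    intro a b
    apply hinj
    rw [map_mul, hf0, hf0, ← hF, key]
    rfl
  refine ⟨{ toFun := f0, map_add' := ?_, map_smul' := ?_ }, hmul, ?_⟩
  · intro a b
    apply hinj
    rw [map_add, hf0, hf0, hf0, map_add]
    rfl
  · intro c x
    rw [RingHom.id_apply, Algebra.smul_def, Algebra.smul_def, ← hmul, ← hF, hk]
  · apply hinj
    change F (f0 1) = F 1
    rw [hf0, map_one F]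
    have := LinearMap.congr_fun hg 1
    simp at this
    rw [this]; rfl

variable {S : Type*} [CommRing S] [IsDomain S] [Algebra k S] {N : ℕ}

lemma mon_split (y : Fin N → S) (q : ℕ) (a : Fin N → ℕ) :
    mon y a = mon y (fun j => a j / q) ^ q * mon y (fun j => a j % q) := by
  rw [← mon_nsmul, ← mon_add]
  congr 1
  ext j
  simp [Nat.div_add_mod]

lemma exists_kappa (y : Fin N → S) (hy : Algebra.adjoin k (Set.range y) = ⊤) :
    ∃ κ : S →ₗ[k] S, (∀ a b, κ (a ^ Fintype.card k * b) = a * κ b) ∧ κ 1 ≠ 0 := by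
  classical
  let K := FractionRing S
  obtain ⟨f, hf, hf1⟩ := exists_lam (k := k) K
  set q := Fintype.card k with hq
  have hq0 : 0 < q := Fintype.card_pos
  obtain ⟨d, hd⟩ := IsLocalization.exist_integer_multiples_of_finite (nonZeroDivisors S)
    (fun β : Fin N → Fin q => f (algebraMap S K (mon y (fun j => (β j : ℕ)))))
  let am : S →ₐ[k] K := IsScalarTower.toAlgHom k S K
  have ham : Function.Injective am := IsFractionRing.injective S K
  let G : S →ₗ[k] K := (LinearMap.mulLeft k (am d)) ∘ₗ f ∘ₗ am.toLinearMap
  have hG : ∀ a b, G (a ^ q * b) = am a * G b := by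
    intro a b
    simp only [G, LinearMap.comp_apply, AlgHom.toLinearMap_apply, map_mul, map_pow,
      LinearMap.mulLeft_apply, hf]
    ring
  have hmem : ∀ x, G x ∈ LinearMap.range am.toLinearMap := by
    intro x
    obtain ⟨t, ht⟩ := filt_exh (k := k) y hy x
    have : filt k y t ≤ (LinearMap.range am.toLinearMap).comap G := by
      refine filt_induct y t _ fun a _ => ?_
      rw [Submodule.mem_comap, mon_split y q, hG]
      obtain ⟨z, hz⟩ := hd (fun j => ⟨a j % q, Nat.mod_lt _ hq0⟩)
      refine ⟨mon y (fun j => a j / q) * z, ?_⟩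
      simp only [AlgHom.toLinearMap_apply, map_mul]
      congr 1
      refine Eq.trans hz ?_
      simp only [Algebra.smul_def]
      rfl
    exact this ht
  let e := LinearEquiv.ofInjective am.toLinearMap ham
  let κ : S →ₗ[k] S := e.symm.toLinearMap ∘ₗ G.codRestrict _ hmem
  have hκ : ∀ x, am (κ x) = G x := by
    intro x
    have := congrArg Subtype.val (e.apply_symm_apply (G.codRestrict _ hmem x))
    exact this
  refine ⟨κ, ?_, ?_⟩
  · intro a b
    apply ham
    rw [hκ, hG, map_mul am, hκ]
  · intro h
    have := hκ 1
    rw [h, map_zero] at this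
    have h2 : G 1 = am d := by simp [G, hf1]
    rw [h2] at this
    have h3 : (d : S) = 0 := ham (by rw [map_zero]; exact this.symm)
    exact nonZeroDivisors.ne_zero d.2 h3

lemma exists_pi (y : Fin N → S) (hy : Algebra.adjoin k (Set.range y) = ⊤) :
    ∃ (π : (Fin N → Fin (Fintype.card k)) → S →ₗ[k] S) (s : ℕ),
      (∀ i a b, π i (a ^ Fintype.card k * b) = a * π i b) ∧
      (∀ x, (∀ i, π i x = 0) → x = 0) ∧
      (∀ i t x, x ∈ filt k y t → π i x ∈ filt k y (t / Fintype.card k + s)) := by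
  classical
  obtain ⟨κ, hκ, hκ1⟩ := exists_kappa (k := k) y hy
  set q := Fintype.card k with hq
  have hq0 : 0 < q := Fintype.card_pos
  obtain ⟨s0, hs0⟩ := filt_exh_fam (k := k) y hy
    (fun β : Fin N → Fin q => κ (mon y (fun j => (β j : ℕ))))
  refine ⟨fun β => κ ∘ₗ LinearMap.mulLeft k (mon y (fun j => (β j : ℕ))), N + s0, ?_, ?_, ?_⟩
  · intro i a b
    simp only [LinearMap.comp_apply, LinearMap.mulLeft_apply]
    rw [← hκ]; congr 1; ring
  · intro x hx
    have h1 : ∀ c, κ (c * x) = 0 := by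
      intro c
      obtain ⟨t, ht⟩ := filt_exh (k := k) y hy c
      have : filt k y t ≤ LinearMap.ker (κ ∘ₗ LinearMap.mulRight k x) := by
        refine filt_induct y t _ fun a _ => ?_
        rw [LinearMap.mem_ker, mon_split y q, LinearMap.comp_apply, LinearMap.mulRight_apply,
          mul_assoc, hκ]
        have := hx (fun j => ⟨a j % q, Nat.mod_lt _ hq0⟩)
        simp only [LinearMap.comp_apply, LinearMap.mulLeft_apply] at this
        rw [this, mul_zero]
      simpa using this ht
    have h2 : x * κ 1 = 0 := by
      rw [← hκ, mul_one]
      have := h1 (x ^ (q - 1))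
      rwa [← pow_succ, Nat.sub_add_cancel hq0] at this
    exact (mul_eq_zero.1 h2).resolve_right hκ1
  · intro β t x hx
    refine filt_map y t _ _ (fun a ha => ?_) hx
    simp only [LinearMap.comp_apply, LinearMap.mulLeft_apply]
    rw [← mon_add, mon_split y q, hκ]
    have h1 := hs0 (fun j => ⟨((fun j => (β j : ℕ)) + a) j % q, Nat.mod_lt _ hq0⟩)
    refine filt_mono y ?_ (filt_mul y (mon_mem (k := k) y le_rfl) h1)
    rw [← add_assoc]
    refine Nat.add_le_add_right ?_ _
    rw [← Nat.add_mul_div_right _ _ hq0, Nat.le_div_iff_mul_le hq0, Finset.sum_mul]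
    calc ∑ j, (((fun j => (β j : ℕ)) + a) j / q) * q ≤ ∑ j, (a j + q) := by
          refine Finset.sum_le_sum fun j _ => ?_
          refine (Nat.div_mul_le_self _ _).trans ?_
          have := (β j).2
          simp only [Pi.add_apply]
          omega
      _ ≤ t + N * q := by
          rw [Finset.sum_add_distrib]; simp; omega

end frob
end PerDense

namespace PerDense

section words
variable {k S : Type*} [Field k] [CommRing S] [Algebra k S] {N : ℕ} {ι : Type*}

def wd (π : ι → S →ₗ[k] S) : (n : ℕ) → (Fin n → ι) → S →ₗ[k] S
  | 0, _ => LinearMap.id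
  | n + 1, J => π (J 0) ∘ₗ wd π n (Fin.tail J)

lemma wd_cons (π : ι → S →ₗ[k] S) (n : ℕ) (i : ι) (J : Fin n → ι) (x : S) :
    wd π (n + 1) (Fin.cons i J) x = π i (wd π n J x) := by
  simp [wd]

lemma wd_lin (π : ι → S →ₗ[k] S) {q : ℕ} (hπ : ∀ i a b, π i (a ^ q * b) = a * π i b)
    (n : ℕ) (J : Fin n → ι) (a b : S) : wd π n J (a ^ q ^ n * b) = a * wd π n J b := by
  induction n generalizing a b with
  | zero => simp [wd]
  | succ n ih =>
    simp only [wd, LinearMap.comp_apply]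
    rw [pow_succ', pow_mul, ih, hπ]

lemma wd_inj (π : ι → S →ₗ[k] S) (hπ : ∀ x, (∀ i, π i x = 0) → x = 0) (n : ℕ) (x : S)
    (h : ∀ J : Fin n → ι, wd π n J x = 0) : x = 0 := by
  induction n with
  | zero => simpa [wd] using h Fin.elim0
  | succ n ih =>
    apply ih
    intro J
    apply hπ
    intro i
    rw [← wd_cons]
    exact h _

lemma wd_deg (y : Fin N → S) (π : ι → S →ₗ[k] S) {q s : ℕ} (hq : 2 ≤ q)
    (hπ : ∀ i t x, x ∈ filt k y t → π i x ∈ filt k y (t / q + s)) (n : ℕ) (J : Fin n → ι)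
    (u : ℕ) {x : S} (hx : x ∈ filt k y (q ^ n * u)) : wd π n J x ∈ filt k y (u + 2 * s) := by
  induction n generalizing u with
  | zero => simp only [wd, LinearMap.id_apply]; exact filt_mono y (by simp) hx
  | succ n ih =>
    simp only [wd, LinearMap.comp_apply]
    have := ih (Fin.tail J) (q * u) (by rwa [← mul_assoc, ← pow_succ])
    refine filt_mono y ?_ (hπ _ _ _ this)
    have h1 : (q * u + 2 * s) / q = u + 2 * s / q := by
      rw [Nat.mul_add_div (by omega)]
    have h2 : 2 * s / q ≤ s := by
      calc 2 * s / q ≤ 2 * s / 2 := Nat.div_le_div_left hq (by norm_num)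
        _ = s := by omega
    omega

lemma exists_h [IsDomain S] [Finite k] (y : Fin N → S)
    (hy : Algebra.adjoin k (Set.range y) = ⊤) (π : ι → S →ₗ[k] S)
    (hπ : ∀ x, (∀ i, π i x = 0) → x = 0) (b : ℕ) :
    ∃ (h : S) (m : ℕ), h ≠ 0 ∧ ∀ a ∈ filt k y b, a ≠ 0 → ∃ i, ∃ x ∈ filt k y m, h = x * π i a := by
  classical
  have : Finite (filt k y b) := Module.finite_of_finite k
  let B := {a : filt k y b // a ≠ 0}
  have : Fintype B := Fintype.ofFinite B
  have hB : ∀ a : B, ∃ i, π i a ≠ 0 := by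
    intro a
    by_contra! hc
    exact a.2 (Subtype.ext (hπ _ hc))
  choose i hi using hB
  obtain ⟨m, hm⟩ := filt_exh_fam (k := k) y hy
    (fun a : B => ∏ c ∈ Finset.univ.erase a, π (i c) c)
  refine ⟨∏ a : B, π (i a) a, m, Finset.prod_ne_zero_iff.2 fun a _ => hi a, ?_⟩
  intro a ha ha0
  let a' : B := ⟨⟨a, ha⟩, fun h => ha0 (congrArg Subtype.val h)⟩
  refine ⟨i a', _, hm a', ?_⟩
  rw [← Finset.prod_erase_mul _ _ (Finset.mem_univ a')]

lemma exists_h' [IsDomain S] [Finite k] (y : Fin N → S)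
    (hy : Algebra.adjoin k (Set.range y) = ⊤) (π : ι → S →ₗ[k] S)
    {q s : ℕ} (hq : 2 ≤ q)
    (hπ : ∀ x, (∀ i, π i x = 0) → x = 0)
    (hπd : ∀ i t x, x ∈ filt k y t → π i x ∈ filt k y (t / q + s)) :
    ∃ (h : S) (m : ℕ), h ≠ 0 ∧ ∀ a ≠ 0, ∃ n0, ∀ n ≥ n0, ∃ J : Fin n → ι, ∃ x ∈ filt k y m,
      h = x * wd π n J a := by
  obtain ⟨h, m, hh, H⟩ := exists_h y hy π hπ (1 + 2 * s)
  refine ⟨h, m, hh, fun a ha => ?_⟩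
  obtain ⟨t, ht⟩ := filt_exh (k := k) y hy a
  refine ⟨t + 1, fun n hn => ?_⟩
  obtain ⟨n, rfl⟩ : ∃ n', n = n' + 1 := ⟨n - 1, by omega⟩
  have h1 : t ≤ q ^ n * 1 := by
    have := Nat.lt_pow_self (n := n) (show 1 < q by omega)
    omega
  have h2 : ∃ J : Fin n → ι, wd π n J a ≠ 0 := by
    by_contra! hc
    exact ha (wd_inj π hπ n a hc)
  obtain ⟨J, hJ⟩ := h2
  obtain ⟨i, x, hx, e⟩ := H _ (wd_deg y π hq hπd n J 1 (filt_mono y h1 ht)) hJ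
  exact ⟨Fin.cons i J, x, hx, by rw [wd_cons, e]⟩

end words

section minsupp

lemma minsupp {K ι : Type*} [Field K] [Fintype ι] (R : Submodule K (ι → K)) (hR : R ≠ ⊥)
    (Q : ℕ) (hQ : 0 < Q) (hst : ∀ v ∈ R, (fun i => v i ^ Q) ∈ R) :
    ∃ v ∈ R, v ≠ 0 ∧ ∀ i, v i ^ Q = v i := by
  classical
  obtain ⟨w, hw, hw0⟩ := R.exists_mem_ne_zero_of_ne_bot hR
  let sup : (ι → K) → ℕ := fun v => (Finset.univ.filter fun i => v i ≠ 0).card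
  have hex : ∃ n, ∃ v ∈ R, v ≠ 0 ∧ sup v = n := ⟨_, w, hw, hw0, rfl⟩
  obtain ⟨v, hv, hv0, hvn⟩ := Nat.find_spec hex
  have hmin : ∀ u ∈ R, u ≠ 0 → sup v ≤ sup u := fun u hu hu0 => by
    rw [hvn]; exact Nat.find_min' hex ⟨u, hu, hu0, rfl⟩
  obtain ⟨i0, hi0⟩ : ∃ i, v i ≠ 0 := by
    by_contra! hc; exact hv0 (funext hc)
  let v' := (v i0)⁻¹ • v
  have hv' : v' ∈ R := R.smul_mem _ hv
  have hv'1 : v' i0 = 1 := by simp [v', hi0]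
  refine ⟨v', hv', fun h => by rw [h] at hv'1; simp at hv'1, ?_⟩
  have hd : (fun i => v' i ^ Q) - v' ∈ R := R.sub_mem (hst _ hv') hv'
  by_contra! hc
  obtain ⟨j, hj⟩ := hc
  have hd0 : (fun i => v' i ^ Q) - v' ≠ 0 := by
    intro h
    exact hj (sub_eq_zero.1 (congrFun h j))
  have := hmin _ hd hd0
  have hlt : sup ((fun i => v' i ^ Q) - v') < sup v := by
    apply Finset.card_lt_card
    rw [Finset.ssubset_iff_of_subset]
    · exact ⟨i0, by simp [hi0], by simp [hv'1]⟩
    · intro i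
      simp only [Finset.mem_filter, Finset.mem_univ, true_and, Pi.sub_apply]
      contrapose!
      intro h
      simp [v', h, hQ.ne']
  omega

end minsupp

section step1
variable {k S : Type*} [Field k] [Fintype k] [CommRing S] [IsDomain S] [Algebra k S] {N : ℕ}
  {ι : Type*}

lemma step1a {κ : Type*} [Fintype κ] (y : Fin N → S)
    (hy : Algebra.adjoin k (Set.range y) = ⊤) (π : ι → S →ₗ[k] S)
    {s : ℕ} 
    (hlin : ∀ i a b, π i (a ^ Fintype.card k * b) = a * π i b)
    (hπ : ∀ x, (∀ i, π i x = 0) → x = 0)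
    (hπd : ∀ i t x, x ∈ filt k y t → π i x ∈ filt k y (t / Fintype.card k + s))
    (H : ∀ (x : FractionRing S) (e : ℕ), 0 < e → x ^ Fintype.card k ^ e = x →
      ∃ c : k, algebraMap k (FractionRing S) c = x)
    (v : κ → S) (hv : LinearIndependent k v) :
    ∃ n, ∀ l : κ → FractionRing S, (∀ J : Fin n → ι,
      ∑ i, l i * algebraMap S (FractionRing S) (wd π n J (v i)) = 0) → l = 0 := by
  classical
  set q := Fintype.card k with hq
  have hq2 : 2 ≤ q := Fintype.one_lt_card
  set K := FractionRing S
  let R : ℕ → Submodule K (κ → K) := fun n =>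
    { carrier := {l | ∀ J : Fin n → ι, ∑ i, l i * algebraMap S K (wd π n J (v i)) = 0}
      add_mem' := by
        intro a b ha hb J
        simp only [Pi.add_apply, add_mul, Finset.sum_add_distrib]
        rw [ha J, hb J, add_zero]
      zero_mem' := by intro J; simp
      smul_mem' := by
        intro c a ha J
        simp only [Pi.smul_apply, smul_eq_mul, mul_assoc]
        rw [← Finset.mul_sum, ha J, mul_zero] }
  have hinj : Function.Injective (algebraMap S K) := IsFractionRing.injective S K
  -- Frobenius step
  have hfr : ∀ n, ∀ l ∈ R (n + 1), (fun i => l i ^ q) ∈ R n := by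
    intro n l hl J
    obtain ⟨d, hd⟩ := IsLocalization.exist_integer_multiples_of_finite (nonZeroDivisors S) l
    choose z hz using hd
    have hd0 : algebraMap S K d ≠ 0 := by
      simpa using nonZeroDivisors.ne_zero d.2
    have hz' : ∀ i, algebraMap S K (z i) = algebraMap S K d * l i := by
      intro i; rw [hz i, Algebra.smul_def]
    have h1 : ∑ i, z i ^ q * wd π n J (v i) = 0 := by
      apply hπ
      intro i
      rw [map_sum]
      simp only [hlin, ← wd_cons]
      apply hinj
      rw [map_sum, map_zero]
      simp only [map_mul, hz', mul_assoc]
      rw [← Finset.mul_sum, hl, mul_zero]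
    have h2 := congrArg (algebraMap S K) h1
    rw [map_sum, map_zero] at h2
    simp only [map_mul, map_pow, hz', mul_pow, mul_assoc] at h2
    rw [← Finset.mul_sum] at h2
    exact (mul_eq_zero.1 h2).resolve_left (pow_ne_zero _ hd0)
  have hfr' : ∀ e n, ∀ l ∈ R (n + e), (fun i => l i ^ q ^ e) ∈ R n := by
    intro e
    induction e with
    | zero => intro n l hl; simpa using hl
    | succ e ih =>
      intro n l hl
      have := ih n _ (hfr (n + e) l hl)
      simpa [← pow_mul, ← pow_succ'] using this
  by_contra! hcon
  have hne : ∀ n, R n ≠ ⊥ := by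
    intro n h
    obtain ⟨l, hl, hl0⟩ := hcon n
    have : l ∈ R n := hl
    rw [h] at this
    exact hl0 (by simpa using this)
  -- finiteness
  obtain ⟨t, ht⟩ := filt_exh_fam (k := k) y hy v
  have hfin : Finite (filt k y (1 + 2 * s)) := Module.finite_of_finite k
  have hwm : ∀ n, ∀ J : Fin (t + n) → ι, ∀ i, wd π (t + n) J (v i) ∈ filt k y (1 + 2 * s) := by
    intro n J i
    refine wd_deg y π hq2 hπd _ J 1 (filt_mono y ?_ (ht i))
    have := Nat.lt_pow_self (n := t + n) (show 1 < q by omega)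
    omega
  let U : ℕ → Set (κ → filt k y (1 + 2 * s)) := fun n =>
    Set.range fun J : Fin (t + n) → ι => fun i => ⟨_, hwm n J i⟩
  have hRU : ∀ n, ∀ l, l ∈ R (t + n) ↔ ∀ w ∈ U n, ∑ i, l i * algebraMap S K (w i) = 0 := by
    intro n l
    constructor
    · rintro h _ ⟨J, rfl⟩
      exact h J
    · intro h J
      exact h _ ⟨J, rfl⟩
  obtain ⟨n, m, hnm, hU⟩ : ∃ n m, n < m ∧ U n = U m := by
    obtain ⟨n, m, h, h'⟩ := Finite.exists_ne_map_eq_of_infinite U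
    rcases lt_or_gt_of_ne h with h1 | h1
    · exact ⟨n, m, h1, h'⟩
    · exact ⟨m, n, h1, h'.symm⟩
  have hRR : R (t + n) = R (t + m) := by
    ext l; rw [hRU, hRU, hU]
  obtain ⟨e, rfl⟩ : ∃ e, m = n + e := ⟨m - n, by omega⟩
  have he : 0 < e := by omega
  obtain ⟨l, hl, hl0, hle⟩ := minsupp (R (t + n)) (hne _) (q ^ e) (by positivity) (by
    intro l hl
    apply hfr' e (t + n) l
    rw [hRR, ← add_assoc] at hl
    exact hl)
  choose c hc using fun i => H (l i) e he (hle i)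
  have h1 : ∑ i, c i • v i = 0 := by
    apply wd_inj π hπ (t + n)
    intro J
    apply hinj
    rw [map_zero, ← hl J, map_sum, map_sum]
    refine Finset.sum_congr rfl fun i _ => ?_
    rw [map_smul, Algebra.smul_def, map_mul, ← IsScalarTower.algebraMap_apply, hc]
  have h2 := Fintype.linearIndependent_iff.1 hv c h1
  apply hl0
  ext i
  rw [← hc, h2]; simp

lemma step1b {κ : Type*} [Fintype κ] [Fintype ι] (i0 : κ) (y : Fin N → S)
    (hy : Algebra.adjoin k (Set.range y) = ⊤) (π : ι → S →ₗ[k] S)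
    {s : ℕ} 
    (hlin : ∀ i a b, π i (a ^ Fintype.card k * b) = a * π i b)
    (hπ : ∀ x, (∀ i, π i x = 0) → x = 0)
    (hπd : ∀ i t x, x ∈ filt k y t → π i x ∈ filt k y (t / Fintype.card k + s))
    (H : ∀ (x : FractionRing S) (e : ℕ), 0 < e → x ^ Fintype.card k ^ e = x →
      ∃ c : k, algebraMap k (FractionRing S) c = x)
    (v : κ → S) (hv : LinearIndependent k v) :
    ∃ n, ∃ x : (Fin n → ι) → S, (∑ J, x J * wd π n J (v i0)) ≠ 0 ∧
      ∀ i ≠ i0, (∑ J, x J * wd π n J (v i)) = 0 := by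
  classical
  obtain ⟨n, hn⟩ := step1a y hy π hlin hπ hπd H v hv
  set K := FractionRing S
  have hinj : Function.Injective (algebraMap S K) := IsFractionRing.injective S K
  let row : κ → ((Fin n → ι) → K) := fun i J => algebraMap S K (wd π n J (v i))
  have hrow : LinearIndependent K row := by
    rw [Fintype.linearIndependent_iff]
    intro g hg
    have := hn g (fun J => by simpa [row] using congrFun hg J)
    intro i; rw [this]; rfl
  obtain ⟨f, hf⟩ : ∃ f : ((Fin n → ι) → K) →ₗ[K] K, ∀ i, f (row i) = if i = i0 then 1 else 0 := by
    let b := Module.Basis.sumExtend hrow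
    refine ⟨b.coord (Sum.inl i0), fun i => ?_⟩
    have : b (Sum.inl i) = row i := by
      simp [b, Module.Basis.sumExtend, Module.Basis.extend]
      rfl
    rw [← this, Module.Basis.coord_apply, Module.Basis.repr_self, Finsupp.single_apply]
    simp
  have hf' : ∀ w, f w = ∑ J, w J * f (Pi.single J 1) := by
    intro w
    conv_lhs => rw [LinearMap.pi_apply_eq_sum_univ f w]
    refine Finset.sum_congr rfl fun J _ => ?_
    rw [smul_eq_mul]
    congr 2
    ext j
    simp [Pi.single_apply, eq_comm]
  obtain ⟨d, hd⟩ := IsLocalization.exist_integer_multiples_of_finite (nonZeroDivisors S)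
    (fun J : Fin n → ι => f (Pi.single J 1))
  choose z hz using hd
  have key : ∀ i, algebraMap S K (∑ J, z J * wd π n J (v i)) =
      algebraMap S K d * f (row i) := by
    intro i
    rw [hf', map_sum, Finset.mul_sum]
    refine Finset.sum_congr rfl fun J _ => ?_
    rw [map_mul, hz, Algebra.smul_def]
    simp only [row]
    ring
  refine ⟨n, z, ?_, ?_⟩
  · intro h
    have := key i0
    rw [h, hf, map_zero, if_pos rfl, mul_one] at this
    have h3 : (d : S) = 0 := hinj (by rw [map_zero]; exact this.symm)
    exact nonZeroDivisors.ne_zero d.2 h3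
  · intro i hi
    apply hinj
    rw [key, hf, if_neg hi]
    simp

end step1
end PerDense

namespace PerDense

section step2
universe v
variable {k : Type*} {S : Type v} [Field k] [Fintype k] [CommRing S] [IsDomain S] [Algebra k S]
  {N : ℕ}

lemma step2 (y : Fin N → S)
    (hy : Algebra.adjoin k (Set.range y) = ⊤)
    (H : ∀ (x : FractionRing S) (e : ℕ), 0 < e → x ^ Fintype.card k ^ e = x →
      ∃ c : k, algebraMap k (FractionRing S) c = x) :
    ∃ (h : S) (μ : ℕ), h ≠ 0 ∧ ∀ (κ : Type v) (_ : Fintype κ) (i0 : κ) (v : κ → S),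
      LinearIndependent k v → ∀ n0, ∃ n ≥ n0, ∃ P : S →ₗ[k] S,
        (∀ a b, P (a ^ Fintype.card k ^ n * b) = a * P b) ∧
        (∀ t x, x ∈ filt k y (Fintype.card k ^ n * t) → P x ∈ filt k y (t + μ)) ∧
        P (v i0) = h ∧ ∀ i ≠ i0, P (v i) = 0 := by
  classical
  set q := Fintype.card k with hq
  obtain ⟨π, s, hlin, hinj, hdeg⟩ := exists_pi (k := k) y hy
  have hq2 : 2 ≤ q := Fintype.one_lt_card
  obtain ⟨h, m, hh0, hh⟩ := exists_h' y hy π hq2 hinj hdeg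
  refine ⟨h, 1 + 2 * s + m, hh0, ?_⟩
  intro κ _ i0 v hv n0
  obtain ⟨n1, x1, hx1, hx0⟩ := step1b i0 y hy π hlin hinj hdeg H v hv
  let ρ : S →ₗ[k] S := ∑ J, (LinearMap.mulLeft k (x1 J)) ∘ₗ wd π n1 J
  have hρ : ∀ x, ρ x = ∑ J, x1 J * wd π n1 J x := by
    intro x; simp [ρ]
  obtain ⟨m1, hm1⟩ := filt_exh_fam (k := k) y hy x1
  have hρ0 : ρ (v i0) ≠ 0 := by rw [hρ]; exact hx1
  have hρ1 : ∀ i ≠ i0, ρ (v i) = 0 := fun i hi => by rw [hρ]; exact hx0 i hi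
  have hρl : ∀ a b, ρ (a ^ q ^ n1 * b) = a * ρ b := by
    intro a b
    rw [hρ, hρ, Finset.mul_sum]
    refine Finset.sum_congr rfl fun J _ => ?_
    rw [wd_lin π hlin]; ring
  have hρd : ∀ t x, x ∈ filt k y (q ^ n1 * t) → ρ x ∈ filt k y (m1 + (t + 2 * s)) := by
    intro t x hx
    rw [hρ]
    exact Submodule.sum_mem _ fun J _ => filt_mul y (hm1 J) (wd_deg y π hq2 hdeg n1 J t hx)
  obtain ⟨n00, hn⟩ := hh _ hρ0
  obtain ⟨n2, hn2⟩ : ∃ n2, n2 = n00 + n0 + (m1 + 2 * s) := ⟨_, rfl⟩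
  obtain ⟨J, x, hx, hJ⟩ := hn n2 (by omega)
  have hQ2 : m1 + 2 * s ≤ q ^ n2 := by
    have := Nat.lt_pow_self (n := n2) (show 1 < q by omega)
    omega
  refine ⟨n1 + n2, by omega, LinearMap.mulLeft k x ∘ₗ wd π n2 J ∘ₗ ρ, ?_, ?_, ?_, ?_⟩
  · intro a b
    simp only [LinearMap.comp_apply, LinearMap.mulLeft_apply]
    rw [add_comm, pow_add, pow_mul, hρl, wd_lin π hlin]
    ring
  · intro t z hz
    simp only [LinearMap.comp_apply, LinearMap.mulLeft_apply]
    rw [pow_add, mul_assoc] at hz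
    have h1 := hρd _ _ hz
    have h2 : m1 + (q ^ n2 * t + 2 * s) ≤ q ^ n2 * (t + 1) := by
      rw [mul_add, mul_one]; omega
    have h3 := wd_deg y π hq2 hdeg n2 J (t + 1) (filt_mono y h2 h1)
    exact filt_mono y (by omega) (filt_mul y hx h3)
  · simp only [LinearMap.comp_apply, LinearMap.mulLeft_apply]
    exact hJ.symm
  · intro i hi
    simp [hρ1 i hi]

end step2

section nilp

lemma nilp_pow {k A : Type*} [Field k] [CommRing A] [Algebra k A] [FiniteDimensional k A]
    (x : A) (hx : IsNilpotent x) (d : ℕ) (hd : Module.finrank k A ≤ d) : x ^ d = 0 := by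
  let f : Module.End k A := LinearMap.mulLeft k x
  have hf : IsNilpotent f := by
    obtain ⟨n, hn⟩ := hx
    exact ⟨n, by rw [LinearMap.pow_mulLeft, hn]; simp⟩
  have h1 := IsNilpotent.charpoly_eq_X_pow_finrank hf
  have h2 := LinearMap.aeval_self_charpoly f
  rw [h1, map_pow, Polynomial.aeval_X, LinearMap.pow_mulLeft] at h2
  have h3 := LinearMap.congr_fun h2 1
  simp at h3
  exact pow_eq_zero_of_le hd h3

variable {k S : Type*} [Field k] [Fintype k] [CommRing S] [Algebra k S] {N : ℕ}

def frI (y : Fin N → S) (Φ : S →ₐ[k] S) (Q : ℕ) : Ideal S :=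
  Ideal.span (Set.range fun j => y j ^ Q - Φ (y j))

lemma frI_mem (y : Fin N → S) (hy : Algebra.adjoin k (Set.range y) = ⊤) (Φ : S →ₐ[k] S) (n : ℕ)
    (x : S) : x ^ Fintype.card k ^ n - Φ x ∈ frI y Φ (Fintype.card k ^ n) := by
  set I := frI y Φ (Fintype.card k ^ n)
  let Fr : S →ₐ[k] S := (FiniteField.frobeniusAlgHom k S) ^ n
  have hFr : ∀ x, Fr x = x ^ Fintype.card k ^ n := by
    intro x
    simp only [Fr]
    induction n generalizing x with
    | zero => simp
    | succ n ih =>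
      rw [pow_succ', AlgHom.mul_apply, ih, pow_succ, pow_mul]
      rfl
  have h : (Ideal.Quotient.mkₐ k I).comp Fr = (Ideal.Quotient.mkₐ k I).comp Φ := by
    apply AlgHom.ext_of_adjoin_eq_top hy
    rintro _ ⟨j, rfl⟩
    simp only [AlgHom.comp_apply, Ideal.Quotient.mkₐ_eq_mk]
    rw [Ideal.Quotient.eq, hFr]
    exact Ideal.subset_span ⟨j, rfl⟩
  have := AlgHom.congr_fun h x
  simp only [AlgHom.comp_apply, Ideal.Quotient.mkₐ_eq_mk] at this
  rwa [Ideal.Quotient.eq, hFr] at this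

lemma frI_iter (y : Fin N → S) (hy : Algebra.adjoin k (Set.range y) = ⊤) (Φ : S →ₐ[k] S) (n : ℕ)
    (m : ℕ) (x : S) :
    x ^ (Fintype.card k ^ n) ^ m - Φ^[m] x ∈ frI y Φ (Fintype.card k ^ n) := by
  induction m generalizing x with
  | zero => simp
  | succ m ih =>
    have h1 := ih (Φ x)
    have h2 := frI_mem y hy Φ n (x ^ (Fintype.card k ^ n) ^ m)
    rw [← pow_mul, ← pow_succ, map_pow] at h2
    rw [Function.iterate_succ_apply]
    have := add_mem h2 h1
    simpa using this

lemma frI_box (y : Fin N → S) (Φ : S →ₐ[k] S) (Q δ : ℕ) (hQ : δ < Q)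
    (hδ : ∀ j, Φ (y j) ∈ filt k y δ) (t : ℕ) :
    filt k y t ≤ Submodule.span k (Set.range fun β : Fin N → Fin Q => mon y (fun j => (β j : ℕ)))
      ⊔ (frI y Φ Q).restrictScalars k := by
  induction t using Nat.strong_induction_on with
  | _ t ih =>
    refine filt_induct y t _ fun a ha => ?_
    by_cases hb : ∀ j, a j < Q
    · exact Submodule.mem_sup_left (Submodule.subset_span ⟨fun j => ⟨a j, hb j⟩, rfl⟩)
    · push Not at hb
      obtain ⟨j, hj⟩ := hb
      let b : Fin N → ℕ := Function.update a j (a j - Q)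
      have hab : a = b + Pi.single j Q := by
        ext i
        by_cases hi : i = j
        · subst hi; simp [b, hj]
        · simp [b, hi]
      have hms : mon y (Pi.single j Q) = y j ^ Q := by
        simp only [mon]
        rw [Finset.prod_eq_single j]
        · simp
        · intro b _ hb; simp [hb]
        · simp
      have hbs : ∑ i, b i + Q = ∑ i, a i := by
        conv_rhs => rw [hab]
        simp [Finset.sum_add_distrib]
      have e : mon y a = Φ (y j) * mon y b + mon y b * (y j ^ Q - Φ (y j)) := by
        rw [hab, mon_add, hms]; ring
      rw [e]
      refine add_mem ?_ ?_
      · refine ih (δ + ∑ i, b i) (by omega) (filt_mul y (hδ j) (mon_mem y le_rfl))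
      · apply Submodule.mem_sup_right
        exact Ideal.mul_mem_left _ _ (Ideal.subset_span ⟨j, rfl⟩)

lemma frI_rad (y : Fin N → S) (hy : Algebra.adjoin k (Set.range y) = ⊤) (Φ : S →ₐ[k] S) (n : ℕ)
    (δ : ℕ) (hQ : δ < Fintype.card k ^ n)
    (hδ : ∀ j, Φ (y j) ∈ filt k y δ) (g : S) 
    (hg : g ∈ (frI y Φ (Fintype.card k ^ n)).radical) :
    Φ^[N] g ∈ frI y Φ (Fintype.card k ^ n) := by
  classical
  set Q := Fintype.card k ^ n with hQd
  set I := frI y Φ Q with hI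
  let b : (Fin N → Fin Q) → S ⧸ I := fun β => Ideal.Quotient.mkₐ k I (mon y (fun j => (β j : ℕ)))
  have hspan : Submodule.span k (Set.range b) = ⊤ := by
    rw [eq_top_iff]
    rintro x -
    obtain ⟨x, rfl⟩ := Ideal.Quotient.mkₐ_surjective k I x
    obtain ⟨t, ht⟩ := filt_exh (k := k) y hy x
    obtain ⟨z, hz, w, hw, rfl⟩ := Submodule.mem_sup.1 (frI_box y Φ Q δ hQ hδ t ht)
    have hw' : Ideal.Quotient.mkₐ k I w = 0 := by
      rw [Ideal.Quotient.mkₐ_eq_mk]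
      exact Ideal.Quotient.eq_zero_iff_mem.2 hw
    rw [map_add, hw', add_zero]
    have := Submodule.mem_map_of_mem (f := (Ideal.Quotient.mkₐ k I).toLinearMap) hz
    rw [Submodule.map_span, ← Set.range_comp] at this
    exact this
  have hfd : FiniteDimensional k (S ⧸ I) := by
    refine ⟨⟨Finset.univ.image b, ?_⟩⟩
    rw [Finset.coe_image, Finset.coe_univ, Set.image_univ, hspan]
  have hcard : Module.finrank k (S ⧸ I) ≤ Q ^ N := by
    have := finrank_range_le_card (R := k) b
    rw [Set.finrank, hspan, finrank_top] at this
    simpa using this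
  obtain ⟨m, hm⟩ := hg
  have hnil : IsNilpotent (Ideal.Quotient.mk I g) :=
    ⟨m, by rw [← map_pow]; exact Ideal.Quotient.eq_zero_iff_mem.2 hm⟩
  have h1 := nilp_pow (k := k) _ hnil _ hcard
  rw [← map_pow, Ideal.Quotient.eq_zero_iff_mem] at h1
  have h2 := frI_iter y hy Φ n N g
  rw [← hQd] at h2
  have := sub_mem h1 h2
  simpa using this

end nilp

section core
universe v
variable {k : Type*} {S : Type v} [Field k] [Fintype k] [CommRing S] [IsDomain S] [Algebra k S]
  {N : ℕ}

theorem core (y : Fin N → S)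
    (hy : Algebra.adjoin k (Set.range y) = ⊤)
    (H : ∀ (x : FractionRing S) (e : ℕ), 0 < e → x ^ Fintype.card k ^ e = x →
      ∃ c : k, algebraMap k (FractionRing S) c = x)
    (Φ : S →ₐ[k] S) (hΦ : Function.Injective Φ) (g : S) (hg : g ≠ 0) :
    ∃ n, 0 < n ∧ g ∉ (frI y Φ (Fintype.card k ^ n)).radical := by
  classical
  obtain ⟨h, μ, hh0, hP⟩ := step2 y hy H
  set q := Fintype.card k with hq
  have hq2 : 2 ≤ q := Fintype.one_lt_card
  obtain ⟨δ, hδ⟩ := filt_exh_fam (k := k) y hy (fun j => Φ (y j))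
  set h0 := Φ^[N] g with hh0d
  have hh0n : h0 ≠ 0 := by
    intro h
    apply hg
    apply hΦ.iterate N
    rw [← hh0d, h]
    clear * -
    induction N with
    | zero => rfl
    | succ n ih => rw [Function.iterate_succ_apply, map_zero, ← ih]
  obtain ⟨δ0, hδ0⟩ := filt_exh (k := k) y hy h0
  obtain ⟨r0, hr0⟩ := filt_exh (k := k) y hy h
  set r := r0 + 2 * μ + 4 with hr
  have hhr : h ∈ filt k y r := filt_mono y (by omega) hr0
  let h' : filt k y r := ⟨h, hhr⟩
  have hli : LinearIndepOn k id ({h'} : Set (filt k y r)) := by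
    apply LinearIndepOn.singleton
    intro hc; exact hh0 (congrArg Subtype.val hc)
  let E := hli.extend (Set.subset_univ _)
  let bas := Module.Basis.extend hli
  have hbas : ∀ i, bas i = i := Module.Basis.extend_apply_self hli
  have : Fintype E := FiniteDimensional.fintypeBasisIndex bas
  let i0 : E := ⟨h', Module.Basis.subset_extend hli rfl⟩
  let L : filt k y r →ₗ[k] S := LinearMap.mulLeft k h0 ∘ₗ Φ.toLinearMap ∘ₗ (filt k y r).subtype
  have hL : Function.Injective L := by
    intro a b hab
    apply Subtype.ext
    apply hΦ
    simp only [L, LinearMap.comp_apply, LinearMap.mulLeft_apply, AlgHom.toLinearMap_apply] at hab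
    exact mul_left_cancel₀ hh0n hab
  have hli2 : LinearIndependent k (fun i : E => L (bas i)) :=
    bas.linearIndependent.map' L (LinearMap.ker_eq_bot.2 hL)
  obtain ⟨n, hn, P, hPl, hPd, hP0, hP1⟩ := hP E this i0 _ hli2 (2 * (δ + δ0) + 1)
  have hQ : 2 * (δ + δ0) + 1 < q ^ n := by
    have := Nat.lt_pow_self (n := n) (show 1 < q by omega)
    omega
  refine ⟨n, by omega, fun hgr => ?_⟩
  set Q := q ^ n with hQd
  have hmem : h0 ∈ frI y Φ Q := frI_rad y hy Φ n δ (by rw [← hq, ← hQd]; omega) hδ g hgr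
  obtain ⟨c, hc⟩ := Ideal.mem_span_range_iff_exists_fun.1 hmem
  obtain ⟨d, hd⟩ := filt_exh_fam (k := k) y hy c
  let mulL (x : S) : S →ₗ[k] S := LinearMap.mulLeft k x
  let B : Fin N → S →ₗ[k] S := fun j => P ∘ₗ mulL (c j) ∘ₗ Φ.toLinearMap
  let θ : S →ₗ[k] S := P ∘ₗ mulL h0 ∘ₗ Φ.toLinearMap
  have hθ : θ = ∑ j, (mulL (y j) ∘ₗ B j - B j ∘ₗ mulL (y j)) := by
    ext x
    simp only [θ, B, mulL, LinearMap.comp_apply, LinearMap.mulLeft_apply, LinearMap.sum_apply,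
      LinearMap.sub_apply, AlgHom.toLinearMap_apply]
    rw [← hc, Finset.sum_mul, map_sum]
    refine Finset.sum_congr rfl fun j _ => ?_
    rw [← hPl, ← map_sub, map_mul Φ]
    congr 1
    ring
  have hBd : ∀ j t x, x ∈ filt k y t → B j x ∈ filt k y ((t + 1) / 2 + d + μ) := by
    intro j t x hx
    apply hPd
    have := filt_mul y (hd j) (filt_hom y Φ hδ hx)
    refine filt_mono y ?_ this
    have h1 : t ≤ 2 * ((t + 1) / 2) := by omega
    calc d + δ * t ≤ Q * d + δ * (2 * ((t + 1) / 2)) := by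
          apply add_le_add
          · exact Nat.le_mul_of_pos_left _ (by omega)
          · exact Nat.mul_le_mul_left _ h1
      _ = Q * d + (2 * δ) * ((t + 1) / 2) := by ring
      _ ≤ Q * d + Q * ((t + 1) / 2) := by
          apply Nat.add_le_add_left
          exact Nat.mul_le_mul_right _ (by omega)
      _ = Q * ((t + 1) / 2 + d) := by ring
  have hθd : ∀ t x, 0 < t → x ∈ filt k y t → θ x ∈ filt k y ((t + 1) / 2 + μ) := by
    intro t x ht hx
    apply hPd
    have := filt_mul y hδ0 (filt_hom y Φ hδ hx)
    refine filt_mono y ?_ this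
    have h1 : t ≤ 2 * ((t + 1) / 2) := by omega
    calc δ0 + δ * t ≤ δ0 * t + δ * t := by
          apply Nat.add_le_add_right
          exact Nat.le_mul_of_pos_right _ ht
      _ = (δ + δ0) * t := by ring
      _ ≤ (δ + δ0) * (2 * ((t + 1) / 2)) := Nat.mul_le_mul_left _ h1
      _ = (2 * (δ + δ0)) * ((t + 1) / 2) := by ring
      _ ≤ Q * ((t + 1) / 2) := Nat.mul_le_mul_right _ (by omega)
  -- trace of θ on filt r is one
  have hθh : θ h = h := by
    have : θ h = P (L (bas i0)) := by rw [hbas]; rfl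
    rw [this]; exact hP0
  have hθr : ∀ x ∈ filt k y r, θ x ∈ Submodule.span k {h} := by
    intro x hx
    have h1 : (⊤ : Submodule k (filt k y r)) ≤
        (Submodule.span k {h}).comap (θ ∘ₗ (filt k y r).subtype) := by
      rw [← bas.span_eq, Submodule.span_le]
      rintro _ ⟨i, rfl⟩
      change P (L (bas i)) ∈ Submodule.span k {h}
      by_cases hi : i = i0
      · rw [hi, hP0]; exact Submodule.mem_span_singleton_self h
      · rw [hP1 i hi]; exact zero_mem _
    exact h1 (x := ⟨x, hx⟩) trivial
  have htr : ptr (filt k y r) θ = 1 := by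
    rw [← ptr_le (p := Submodule.span k {h}) _ θ hθr]
    · exact ptr_line h hh0 θ hθh
    · rw [Submodule.span_singleton_le_iff_mem]; exact hhr
  have htr2 : ∀ t, ptr (filt k y (r + t)) θ = 1 := by
    intro t
    induction t with
    | zero => exact htr
    | succ t ih =>
      rw [← ih]
      symm
      apply ptr_le (filt_mono y (by omega))
      intro x hx
      exact filt_mono y (by omega) (hθd _ x (by omega) hx)
  have hfin := htr2 (2 * d + 4)
  rw [hθ, map_sum, Finset.sum_eq_zero] at hfin
  · exact zero_ne_one hfin
  · intro j _
    rw [map_sub, sub_eq_zero]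
    set R := r + (2 * d + 4) with hR
    have e1 : ptr (filt k y (R - 1)) (B j ∘ₗ mulL (y j)) =
        ptr (filt k y R) (mulL (y j) ∘ₗ B j) := by
      apply ptr_comm
      · intro x hx
        exact filt_mono y (by omega) (filt_mul y (filt_gen y j) hx)
      · intro x hx
        exact filt_mono y (by omega) (hBd j _ x hx)
    rw [← e1]
    apply ptr_le (filt_mono y (by omega))
    intro x hx
    exact filt_mono y (by omega) (hBd j _ _ (filt_mul y (filt_gen y j) hx))

end core
end PerDense

namespace PerDense

section lc
variable {k F : Type*} [Field k] [Field F] [Algebra k F] {σ : Type*}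

def lcf (l : F →ₗ[k] k) : MvPolynomial σ F →ₗ[k] MvPolynomial σ k :=
  (MvPolynomial.basisMonomials σ k).repr.symm.toLinearMap ∘ₗ
    Finsupp.mapRange.linearMap l ∘ₗ
    ((MvPolynomial.basisMonomials σ F).repr.toLinearMap.restrictScalars k)

lemma lcf_monomial (l : F →ₗ[k] k) (m : σ →₀ ℕ) (a : F) :
    lcf l (MvPolynomial.monomial m a) = MvPolynomial.monomial m (l a) := by
  have h : (MvPolynomial.basisMonomials σ F).repr (MvPolynomial.monomial m a) =
      Finsupp.single m a := by
    have : MvPolynomial.monomial m a = a • MvPolynomial.basisMonomials σ F m := by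
      simp [MvPolynomial.smul_monomial]
    rw [this, map_smul, Module.Basis.repr_self]
    simp
  simp only [lcf, LinearMap.comp_apply, LinearMap.restrictScalars_apply, LinearEquiv.coe_coe]
  rw [h, Finsupp.mapRange.linearMap_apply, Finsupp.mapRange_single,
    Module.Basis.repr_symm_single]
  simp [MvPolynomial.smul_monomial]

lemma lcf_mul (l : F →ₗ[k] k) (c : MvPolynomial σ F) (g : MvPolynomial σ k) :
    lcf l (c * MvPolynomial.map (algebraMap k F) g) = lcf l c * g := by
  induction g using MvPolynomial.induction_on' with
  | add p q hp hq => simp only [map_add, mul_add, hp, hq]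
  | monomial m b =>
    induction c using MvPolynomial.induction_on' with
    | add p q hp hq => simp only [map_add, add_mul, hp, hq]
    | monomial m' a =>
      rw [MvPolynomial.map_monomial, MvPolynomial.monomial_mul, lcf_monomial, lcf_monomial,
        MvPolynomial.monomial_mul]
      congr 1
      rw [mul_comm a, ← Algebra.smul_def, map_smul, smul_eq_mul, mul_comm]

variable {T : Type*} [CommRing T] [Algebra k T] [Algebra F T] [IsScalarTower k F T]

lemma lcf_ker (y : σ → T) (G : Set (MvPolynomial σ k))
    (hker : RingHom.ker (MvPolynomial.aeval y : MvPolynomial σ F →ₐ[F] T) =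
      Ideal.span (MvPolynomial.map (algebraMap k F) '' G))
    (l : F →ₗ[k] k) (p : MvPolynomial σ F) (hp : MvPolynomial.aeval y p = 0) :
    MvPolynomial.aeval y (lcf l p) = 0 := by
  have hp' : p ∈ Ideal.span (MvPolynomial.map (algebraMap k F) '' G) := by
    rw [← hker]; exact hp
  induction hp' using Submodule.span_induction generalizing l with
  | mem x hx =>
    obtain ⟨g, hg, rfl⟩ := hx
    rw [MvPolynomial.aeval_map_algebraMap] at hp
    have := lcf_mul l 1 g
    rw [one_mul] at this
    rw [this, map_mul, hp, mul_zero]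
  | zero => simp
  | add x z hx hz ihx ihz =>
    change x ∈ Ideal.span _ at hx
    change z ∈ Ideal.span _ at hz
    rw [← hker] at hx hz
    rw [map_add, map_add, ihx l hx, ihz l hz, add_zero]
  | smul a x hx ih =>
    clear ih hp
    induction hx using Submodule.span_induction generalizing a with
    | mem x hx =>
      obtain ⟨g, hg, rfl⟩ := hx
      have : MvPolynomial.map (algebraMap k F) g ∈
          RingHom.ker (MvPolynomial.aeval y : MvPolynomial σ F →ₐ[F] T) := by
        rw [hker]; exact Ideal.subset_span ⟨g, hg, rfl⟩
      have h2 : MvPolynomial.aeval y (MvPolynomial.map (algebraMap k F) g) = 0 := this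
      rw [MvPolynomial.aeval_map_algebraMap] at h2
      rw [smul_eq_mul, lcf_mul, map_mul, h2, mul_zero]
    | zero => simp
    | add x z _ _ ihx ihz => rw [smul_add, map_add, map_add, ihx, ihz, add_zero]
    | smul b x _ ih => rw [smul_smul]; exact ih _

lemma lin_disj (y : σ → T) (G : Set (MvPolynomial σ k))
    (hker : RingHom.ker (MvPolynomial.aeval y : MvPolynomial σ F →ₐ[F] T) =
      Ideal.span (MvPolynomial.map (algebraMap k F) '' G))
    (s t : MvPolynomial σ k) (c : F)
    (h : MvPolynomial.aeval y s = c • MvPolynomial.aeval y t)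
    (ht : (MvPolynomial.aeval y t : T) ≠ 0) : ∃ d : k, algebraMap k F d = c := by
  by_contra hc
  have hli : LinearIndependent k ![(1 : F), c] := by
    rw [LinearIndependent.pair_iff' one_ne_zero]
    intro a ha
    exact hc ⟨a, by rw [← ha, Algebra.smul_def, mul_one]⟩
  obtain ⟨l, hl⟩ : ∃ l : F →ₗ[k] k, l 1 = 0 ∧ l c = 1 := by
    have hc' : c ∉ Submodule.span k {(1 : F)} := by
      intro h
      obtain ⟨a, ha⟩ := Submodule.mem_span_singleton.1 h
      exact hc ⟨a, by rw [← ha, Algebra.smul_def, mul_one]⟩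
    obtain ⟨f, hf1, hf2⟩ := Submodule.exists_le_ker_of_notMem hc'
    refine ⟨(f c)⁻¹ • f, ?_, ?_⟩
    · have : f 1 = 0 := hf2 (Submodule.mem_span_singleton_self _)
      simp [this]
    · simp [hf1]
  have h0 : MvPolynomial.aeval y (MvPolynomial.C 1 * MvPolynomial.map (algebraMap k F) s -
      MvPolynomial.C c * MvPolynomial.map (algebraMap k F) t) = 0 := by
    simp only [map_sub, map_mul, MvPolynomial.aeval_map_algebraMap, MvPolynomial.aeval_C, h,
      Algebra.smul_def, map_one, one_mul, sub_self]
  have h1 := lcf_ker y G hker l _ h0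
  have hC : ∀ a : F, lcf l (MvPolynomial.C a : MvPolynomial σ F) = MvPolynomial.C (l a) :=
    fun a => lcf_monomial l 0 a
  rw [map_sub, lcf_mul, lcf_mul, hC, hC, hl.1, hl.2] at h1
  simp at h1
  exact ht h1

end lc

section point

lemma exists_point {k F S : Type*} [Field k] [Field F] [IsAlgClosed F] [Algebra k F] [CommRing S]
    [Algebra k S] [Algebra.FiniteType k S] (I : Ideal S) (g : S) (hg : g ∉ I.radical) :
    ∃ χ : S →ₐ[k] F, (∀ x ∈ I, χ x = 0) ∧ χ g ≠ 0 := by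
  let g' := Ideal.Quotient.mk I g
  let A := Localization.Away g'
  have : Algebra.FiniteType (S ⧸ I) A := IsLocalization.finiteType_of_monoid_fg (Submonoid.powers g') A
  have : Algebra.FiniteType k A := Algebra.FiniteType.trans (S := S ⧸ I) inferInstance inferInstance
  have : Nontrivial A := by
    rw [← not_subsingleton_iff_nontrivial]
    intro hs
    have h0 : (1 : A) = 0 := Subsingleton.elim _ _
    have h1 : algebraMap (S ⧸ I) A 1 = 0 := by rw [map_one]; exact h0
    rw [IsLocalization.map_eq_zero_iff (Submonoid.powers g')] at h1
    obtain ⟨⟨_, n, rfl⟩, hn⟩ := h1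
    apply hg
    refine ⟨n, ?_⟩
    rw [mul_one] at hn
    rw [← Ideal.Quotient.eq_zero_iff_mem, map_pow]
    exact hn
  obtain ⟨m, hm⟩ := Ideal.exists_maximal A
  let L := A ⧸ m
  letI : Field L := Ideal.Quotient.field m
  have : Module.Finite k L := finite_of_finite_type_of_isJacobsonRing k L
  have : Algebra.IsAlgebraic k L := Algebra.IsAlgebraic.of_finite k L
  let j : L →ₐ[k] F := IsAlgClosed.lift
  let χ : S →ₐ[k] F := ((j.comp (Ideal.Quotient.mkₐ k m)).comp
    (IsScalarTower.toAlgHom k (S ⧸ I) A)).comp (Ideal.Quotient.mkₐ k I)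
  refine ⟨χ, ?_, ?_⟩
  · intro x hx
    have : Ideal.Quotient.mkₐ k I x = 0 := Ideal.Quotient.eq_zero_iff_mem.2 hx
    simp only [χ, AlgHom.comp_apply, this, map_zero]
  · have hu : IsUnit (algebraMap (S ⧸ I) A g') := IsLocalization.Away.algebraMap_isUnit g'
    have : IsUnit (χ g) := hu.map ((j.comp (Ideal.Quotient.mkₐ k m)))
    exact this.ne_zero

lemma mem_of_pow_eq {F K : Type*} [Field F] [IsAlgClosed F] [Field K] [Algebra F K] (x : K) (Q : ℕ)
    (hQ : 1 < Q) (hx : x ^ Q = x) : ∃ c : F, algebraMap F K c = x := by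
  have hint : IsIntegral F x := by
    refine ⟨Polynomial.X ^ Q - Polynomial.X, ?_, ?_⟩
    · apply Polynomial.monic_X_pow_sub
      rw [Polynomial.degree_X]
      exact_mod_cast hQ
    · simp [hx]
  exact minpoly.mem_range_of_degree_eq_one F x
    (IsAlgClosed.degree_eq_one_of_irreducible F (minpoly.irreducible hint))

end point
end PerDense

namespace PerDense

/-- `F` is a union of finite subfields -/
def LocFin (F : Type*) [Field F] : Prop :=
  ∀ C : Set F, C.Finite → ∃ k : Subfield F, Finite k ∧ C ⊆ k

lemma locFin_of (p : ℕ) (hp : p.Prime) (F : Type*) [Field F] [CharP F p]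
    (halg : letI := ZMod.algebra F p; Algebra.IsAlgebraic (ZMod p) F) : LocFin F := by
  intro C hC
  letI := ZMod.algebra F p
  haveI : Fact p.Prime := ⟨hp⟩
  haveI : Algebra.IsAlgebraic (ZMod p) F := halg
  haveI : Finite C := hC
  haveI : FiniteDimensional (ZMod p) (IntermediateField.adjoin (ZMod p) C) :=
    IntermediateField.finiteDimensional_adjoin fun x _ => Algebra.IsIntegral.isIntegral x
  have : Finite (IntermediateField.adjoin (ZMod p) C) := Module.finite_of_finite (ZMod p)
  exact ⟨(IntermediateField.adjoin (ZMod p) C).toSubfield, this,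
    IntermediateField.subset_adjoin (ZMod p) C⟩

section B0
variable {k F T : Type*} [Field k] [Fintype k] [Field F] [IsAlgClosed F] [Algebra k F]
  [CommRing T] [IsDomain T] [Algebra k T] [Algebra F T] [IsScalarTower k F T]

theorem thmB0 (hF : LocFin F) {N : ℕ} (y : Fin N → T) (G : Set (MvPolynomial (Fin N) k))
    (hsurj : Function.Surjective (MvPolynomial.aeval y : MvPolynomial (Fin N) F →ₐ[F] T))
    (hker : RingHom.ker (MvPolynomial.aeval y : MvPolynomial (Fin N) F →ₐ[F] T) =
      Ideal.span (MvPolynomial.map (algebraMap k F) '' G))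
    (Φ : T →ₐ[F] T) (hΦ : Function.Injective Φ)
    (hΦy : ∀ j, ∃ P : MvPolynomial (Fin N) k, MvPolynomial.aeval y P = Φ (y j))
    (g : T) (hg : g ≠ 0) (hgk : ∃ P : MvPolynomial (Fin N) k, MvPolynomial.aeval y P = g) :
    ∃ (χ : T →ₐ[F] F) (M : ℕ), 0 < M ∧ (∀ i, χ (Φ^[i] g) ≠ 0) ∧ ∀ x, χ (Φ^[M] x) = χ x := by
  classical
  let ρ : MvPolynomial (Fin N) k →ₐ[k] T := MvPolynomial.aeval y
  let S : Subalgebra k T := ρ.range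
  let y' : Fin N → S := fun j => ρ.rangeRestrict (MvPolynomial.X j)
  have hy'v : ∀ j, (y' j : T) = y j := fun j => by
    simp [y', ρ]
  have hy' : Algebra.adjoin k (Set.range y') = ⊤ := by
    have : Set.range y' = ρ.rangeRestrict '' Set.range MvPolynomial.X := by
      rw [← Set.range_comp]; rfl
    rw [this, ← AlgHom.map_adjoin, MvPolynomial.adjoin_range_X, Algebra.map_top,
      AlgHom.range_eq_top]
    exact ρ.rangeRestrict_surjective
  have hft : Algebra.FiniteType k S := 
    Algebra.FiniteType.of_surjective ρ.rangeRestrict ρ.rangeRestrict_surjective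
  have hΦS : ∀ s : S, Φ s ∈ S := by
    have h1 : Algebra.adjoin k (Set.range y') ≤
        S.comap ((Φ.restrictScalars k).comp S.val) := by
      rw [Algebra.adjoin_le_iff]
      rintro _ ⟨j, rfl⟩
      obtain ⟨P, hP⟩ := hΦy j
      refine ⟨P, ?_⟩
      change MvPolynomial.aeval y P = Φ (y' j)
      rw [hP, hy'v]
    intro s
    have h2 : s ∈ Algebra.adjoin k (Set.range y') := hy' ▸ Algebra.mem_top
    exact h1 h2
  let ΦS : S →ₐ[k] S := AlgHom.codRestrict ((Φ.restrictScalars k).comp S.val) S hΦS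
  have hΦSv : ∀ s : S, ((ΦS s : S) : T) = Φ s := fun s => rfl
  have hΦSi : Function.Injective ΦS := by
    intro a b hab
    apply Subtype.ext
    apply hΦ
    rw [← hΦSv, ← hΦSv, hab]
  let gS : S := ⟨g, by obtain ⟨P, hP⟩ := hgk; exact ⟨P, hP⟩⟩
  have hgS : gS ≠ 0 := fun h => hg (congrArg Subtype.val h)
  have hq2 : 1 < Fintype.card k := Fintype.one_lt_card
  have H : ∀ (x : FractionRing S) (e : ℕ), 0 < e → x ^ Fintype.card k ^ e = x →
      ∃ c : k, algebraMap k (FractionRing S) c = x := by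
    intro x e he hx
    obtain ⟨s, t, ht, rfl⟩ := IsFractionRing.div_surjective (A := S) x
    have ht0 : t ≠ 0 := nonZeroDivisors.ne_zero ht
    have hinj : Function.Injective (algebraMap S (FractionRing S)) :=
      IsFractionRing.injective S (FractionRing S)
    have ht0' : algebraMap S (FractionRing S) t ≠ 0 := by simpa using ht0
    set Q := Fintype.card k ^ e with hQ
    have hQ1 : 1 < Q := Nat.one_lt_pow he.ne' hq2
    have h1 : s ^ Q * t = s * t ^ Q := by
      apply hinj
      rw [div_pow, div_eq_div_iff (pow_ne_zero _ ht0') ht0'] at hx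
      simpa using hx
    have h2 : (s : T) ^ Q * t = s * t ^ Q := by
      have := congrArg Subtype.val h1
      simpa using this
    have htT : (t : T) ≠ 0 := fun h => ht0 (Subtype.ext h)
    have htT' : algebraMap T (FractionRing T) t ≠ 0 := by simpa using htT
    have h3 : (algebraMap T (FractionRing T) s / algebraMap T (FractionRing T) t) ^ Q =
        algebraMap T (FractionRing T) s / algebraMap T (FractionRing T) t := by
      rw [div_pow, div_eq_div_iff (pow_ne_zero _ htT') htT']
      have := congrArg (algebraMap T (FractionRing T)) h2
      simpa using this
    obtain ⟨c, hc⟩ := mem_of_pow_eq (F := F) _ Q hQ1 h3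
    have h4 : (s : T) = c • (t : T) := by
      apply IsFractionRing.injective T (FractionRing T)
      rw [Algebra.smul_def, map_mul, ← IsScalarTower.algebraMap_apply, hc,
        div_mul_cancel₀ _ htT']
    obtain ⟨s', hs'⟩ := s.2
    obtain ⟨t', ht'⟩ := t.2
    obtain ⟨d, hd⟩ := lin_disj y G hker s' t' c (by
      have e1 : MvPolynomial.aeval y s' = (s : T) := hs'
      have e2 : MvPolynomial.aeval y t' = (t : T) := ht'
      rw [e1, e2, h4]) (by
      have e2 : MvPolynomial.aeval y t' = (t : T) := ht'
      rw [e2]; exact htT)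
    refine ⟨d, ?_⟩
    rw [eq_div_iff ht0', IsScalarTower.algebraMap_apply k S (FractionRing S), ← map_mul]
    congr 1
    apply Subtype.ext
    rw [h4, ← hd, ← Algebra.smul_def, algebraMap_smul]
    rfl
  obtain ⟨n, hn0, hn⟩ := core y' hy' H ΦS hΦSi gS hgS
  obtain ⟨χ0, hχI, hχg⟩ := exists_point (k := k) (F := F) _ gS hn
  set Q := Fintype.card k ^ n with hQ
  have hχΦ : ∀ s, χ0 (ΦS s) = χ0 s ^ Q := by
    intro s
    have := hχI _ (frI_mem y' hy' ΦS n s)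
    rw [map_sub, map_pow, sub_eq_zero] at this
    exact this.symm
  have hχΦi : ∀ i s, χ0 (ΦS^[i] s) = (fun z => z ^ Q)^[i] (χ0 s) := by
    intro i
    induction i with
    | zero => intro s; rfl
    | succ i ih =>
      intro s
      rw [Function.iterate_succ_apply, Function.iterate_succ_apply, ih, hχΦ]
  have hiter : ∀ i (s : S), Φ^[i] (s : T) = ((ΦS^[i] s : S) : T) := by
    intro i
    induction i with
    | zero => intro s; rfl
    | succ i ih =>
      intro s
      rw [Function.iterate_succ_apply, Function.iterate_succ_apply, ← hΦSv, ih]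
  -- extend to T
  let ev : MvPolynomial (Fin N) F →ₐ[F] F := MvPolynomial.aeval (fun j => χ0 (y' j))
  have hev : ∀ P : MvPolynomial (Fin N) k,
      ev (MvPolynomial.map (algebraMap k F) P) = χ0 (ρ.rangeRestrict P) := by
    intro P
    simp only [ev]
    rw [MvPolynomial.aeval_map_algebraMap]
    have : (MvPolynomial.aeval (fun j => χ0 (y' j)) : MvPolynomial (Fin N) k →ₐ[k] F) =
        χ0.comp ρ.rangeRestrict := by
      apply MvPolynomial.algHom_ext
      intro j
      simp [y']
    rw [this]; rfl
  have hle : RingHom.ker (MvPolynomial.aeval y : MvPolynomial (Fin N) F →ₐ[F] T).toRingHom ≤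
      RingHom.ker ev.toRingHom := by
    change RingHom.ker (MvPolynomial.aeval y : MvPolynomial (Fin N) F →ₐ[F] T) ≤ _
    rw [hker, Ideal.span_le]
    rintro _ ⟨P, hP, rfl⟩
    change ev _ = 0
    rw [hev]
    have h1 : MvPolynomial.map (algebraMap k F) P ∈
          RingHom.ker (MvPolynomial.aeval y : MvPolynomial (Fin N) F →ₐ[F] T) := by
      rw [hker]; exact Ideal.subset_span ⟨P, hP, rfl⟩
    have h2 : MvPolynomial.aeval y (MvPolynomial.map (algebraMap k F) P) = 0 := h1
    rw [MvPolynomial.aeval_map_algebraMap] at h2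
    have h3 : ρ.rangeRestrict P = 0 := Subtype.ext h2
    rw [h3, map_zero]
  let χ : T →ₐ[F] F := AlgHom.liftOfSurjective _ hsurj ev hle
  have hχ : ∀ P, χ (MvPolynomial.aeval y P) = ev P := fun P =>
    AlgHom.liftOfSurjective_apply _ hsurj ev hle P
  have hχS : ∀ s : S, χ s = χ0 s := by
    intro s
    obtain ⟨P, rfl⟩ := ρ.rangeRestrict_surjective s
    rw [← hev, ← hχ, MvPolynomial.aeval_map_algebraMap]
    rfl
  -- the period
  obtain ⟨k', hk', hk'm⟩ := hF (Set.range fun j => χ0 (y' j)) (Set.finite_range _)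
  have hinjQ : Function.Injective (fun z : F => z ^ Q) := by
    have h1 : ∀ z : F, ((FiniteField.frobeniusAlgHom k F) ^ n) z = z ^ Q := by
      intro z
      rw [hQ]
      clear * -
      induction n generalizing z with
      | zero => simp
      | succ n ih =>
        rw [pow_succ', AlgHom.mul_apply, ih, pow_succ, pow_mul]
        rfl
    intro a b hab
    simp only [← h1] at hab
    exact (((FiniteField.frobeniusAlgHom k F) ^ n).toRingHom).injective hab
  let fr : k' → k' := fun z => z ^ Q
  have hfr : Function.Bijective fr := by
    apply Function.Injective.bijective_of_finite
    intro a b hab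
    apply Subtype.ext
    apply hinjQ
    have := congrArg Subtype.val hab
    simpa [fr] using this
  let e : Equiv.Perm k' := Equiv.ofBijective fr hfr
  have he : ∀ i (z : k'), (((e ^ i) z : k') : F) = (fun z => z ^ Q)^[i] (z : F) := by
    intro i
    induction i with
    | zero => intro z; rfl
    | succ i ih =>
      intro z
      rw [pow_succ, Equiv.Perm.mul_apply, ih, Function.iterate_succ_apply]
      rfl
  refine ⟨χ, orderOf e, orderOf_pos e, ?_, ?_⟩
  · intro i
    have : Φ^[i] g = ((ΦS^[i] gS : S) : T) := hiter i gS
    rw [this, hχS, hχΦi]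
    clear * - hχg
    induction i with
    | zero => exact hχg
    | succ i ih => rw [Function.iterate_succ_apply']; exact pow_ne_zero _ ih
  · have hcomp : χ.comp (Φ ^ orderOf e) = χ := by
      have h1 : (χ.comp (Φ ^ orderOf e)).comp (MvPolynomial.aeval y) =
          χ.comp (MvPolynomial.aeval y) := by
        apply MvPolynomial.algHom_ext
        intro j
        simp only [AlgHom.comp_apply, MvPolynomial.aeval_X]
        rw [AlgHom.coe_pow, ← hy'v, hiter, hχS, hχS, hχΦi]
        have h2 := he (orderOf e) ⟨χ0 (y' j), hk'm ⟨j, rfl⟩⟩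
        rw [pow_orderOf_eq_one] at h2
        exact h2.symm
      ext x
      obtain ⟨P, rfl⟩ := hsurj x
      exact AlgHom.congr_fun h1 P
    intro x
    have := AlgHom.congr_fun hcomp x
    rw [AlgHom.comp_apply, AlgHom.coe_pow] at this
    exact this

end B0

theorem thmB {F T : Type*} [Field F] [IsAlgClosed F] (hF : LocFin F)
    [CommRing T] [IsDomain T] [Algebra F T] [Algebra.FiniteType F T]
    (Φ : T →ₐ[F] T) (hΦ : Function.Injective Φ) (g : T) (hg : g ≠ 0) :
    ∃ (χ : T →ₐ[F] F) (M : ℕ), 0 < M ∧ (∀ i, χ (Φ^[i] g) ≠ 0) ∧ ∀ x, χ (Φ^[M] x) = χ x := by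
  classical
  obtain ⟨N, f, hf⟩ := Algebra.FiniteType.iff_quotient_mvPolynomial''.1
    (inferInstance : Algebra.FiniteType F T)
  let y : Fin N → T := fun j => f (MvPolynomial.X j)
  have hfy : f = MvPolynomial.aeval y := by
    apply MvPolynomial.algHom_ext
    intro j; simp [y]
  obtain ⟨K, hK⟩ : (RingHom.ker f).FG := IsNoetherian.noetherian _
  choose GΦ hGΦ using fun j => hf (Φ (y j))
  obtain ⟨Gg, hGg⟩ := hf g
  let D : Set (MvPolynomial (Fin N) F) := ↑K ∪ (Set.range GΦ ∪ {Gg})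
  have hD : D.Finite := K.finite_toSet.union ((Set.finite_range _).union (Set.finite_singleton _))
  let C : Set F := ⋃ P ∈ D, (P.coeffs : Set F)
  have hC : C.Finite := hD.biUnion fun P _ => P.coeffs.finite_toSet
  obtain ⟨k, hk, hCk⟩ := hF C hC
  letI : Fintype k := Fintype.ofFinite k
  have hdesc : ∀ P ∈ D, ∃ P' : MvPolynomial (Fin N) k,
      MvPolynomial.map (algebraMap k F) P' = P := by
    intro P hP
    have : P ∈ (MvPolynomial.map (σ := Fin N) (algebraMap k F)).range := by
      rw [P.as_sum]
      refine Subring.sum_mem _ fun m hm => ?_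
      have hcC : P.coeff m ∈ C := Set.mem_biUnion hP
        (MvPolynomial.coeff_mem_coeffs m (MvPolynomial.mem_support_iff.1 hm))
      refine ⟨MvPolynomial.monomial m ⟨P.coeff m, hCk hcC⟩, ?_⟩
      rw [MvPolynomial.map_monomial]
      rfl
    exact this
  refine thmB0 (k := k) hF y {P' | MvPolynomial.map (algebraMap k F) P' ∈ K} (hfy ▸ hf) ?_ Φ hΦ
    ?_ g hg ?_
  · rw [← hfy, ← hK]
    apply le_antisymm
    · rw [Submodule.span_le]
      intro P hP
      obtain ⟨P', hP'⟩ := hdesc P (Or.inl hP)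
      apply Ideal.subset_span
      exact ⟨P', by change MvPolynomial.map _ P' ∈ K; rw [hP']; exact hP, hP'⟩
    · rw [Ideal.span_le]
      rintro _ ⟨P', hP', rfl⟩
      exact Submodule.subset_span hP'
  · intro j
    obtain ⟨P', hP'⟩ := hdesc (GΦ j) (Or.inr (Or.inl ⟨j, rfl⟩))
    refine ⟨P', ?_⟩
    rw [← hGΦ, hfy, ← hP', MvPolynomial.aeval_map_algebraMap]
  · obtain ⟨P', hP'⟩ := hdesc Gg (Or.inr (Or.inr rfl))
    refine ⟨P', ?_⟩
    rw [← hGg, hfy, ← hP', MvPolynomial.aeval_map_algebraMap]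

end PerDense

namespace PerDense

section ext

lemma ext_hom {F E B : Type*} [Field F] [CommRing E] [Algebra F E] [CommRing B] [Algebra F B]
    (T : Subalgebra F E) (j : B →ₐ[F] E) (γ : T)
    (hj : ∀ b, ∃ n : ℕ, ((γ ^ n : T) : E) * j b ∈ T)
    (χ : T →ₐ[F] F) (hγ : χ γ ≠ 0) :
    ∃ χ' : B →ₐ[F] F, ∀ (t : T) (b : B) (h : (t : E) * j b ∈ T), χ ⟨_, h⟩ = χ t * χ' b := by
  choose n hn using hj
  let f : B → F := fun b => χ ⟨_, hn b⟩ / χ (γ ^ n b)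
  have hp : ∀ m, χ (γ ^ m) ≠ 0 := fun m => by rw [map_pow]; exact pow_ne_zero _ hγ
  have key : ∀ (t : T) (b : B) (h : (t : E) * j b ∈ T), χ ⟨_, h⟩ = χ t * f b := by
    intro t b h
    simp only [f]
    rw [mul_div_assoc', eq_div_iff (hp _), ← map_mul, ← map_mul]
    congr 1
    apply Subtype.ext
    simp only [MulMemClass.coe_mul]
    ring
  refine ⟨AlgHom.ofLinearMap ⟨⟨f, ?_⟩, ?_⟩ ?_ ?_, key⟩
  · intro a b
    have h1 : ((γ ^ n a * γ ^ n b : T) : E) * j a ∈ T := by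
      have := T.mul_mem (γ ^ n b).2 (hn a)
      convert this using 1
      simp only [MulMemClass.coe_mul]; ring
    have h2 : ((γ ^ n a * γ ^ n b : T) : E) * j b ∈ T := by
      have := T.mul_mem (γ ^ n a).2 (hn b)
      convert this using 1
      simp only [MulMemClass.coe_mul]; ring
    have h3 : ((γ ^ n a * γ ^ n b : T) : E) * j (a + b) ∈ T := by
      rw [map_add, mul_add]; exact T.add_mem h1 h2
    have e : (⟨_, h3⟩ : T) = ⟨_, h1⟩ + ⟨_, h2⟩ := by
      apply Subtype.ext
      simp [mul_add]
    have h0 : χ (γ ^ n a * γ ^ n b) ≠ 0 := by rw [map_mul]; exact mul_ne_zero (hp _) (hp _)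
    apply mul_left_cancel₀ h0
    rw [mul_add, ← key _ _ h1, ← key _ _ h2, ← key _ _ h3, e, map_add]
  · intro c b
    have h3 : ((γ ^ n b : T) : E) * j (c • b) ∈ T := by
      rw [map_smul, mul_smul_comm]; exact T.smul_mem (hn b) c
    have e : (⟨_, h3⟩ : T) = c • ⟨_, hn b⟩ := by
      apply Subtype.ext
      simp
    apply mul_left_cancel₀ (hp (n b))
    simp only [RingHom.id_apply]
    rw [← key _ _ h3, e, map_smul, key _ _ (hn b), mul_smul_comm]
  · have h3 : ((1 : T) : E) * j 1 ∈ T := by simp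
    have e : (⟨_, h3⟩ : T) = 1 := by
      apply Subtype.ext
      simp
    have := key _ _ h3
    rw [e, map_one, one_mul] at this
    exact this.symm
  · intro a b
    have h3 : ((γ ^ n a * γ ^ n b : T) : E) * j (a * b) ∈ T := by
      have := T.mul_mem (hn a) (hn b)
      rw [map_mul]
      convert this using 1
      simp only [MulMemClass.coe_mul]; ring
    have e : (⟨_, h3⟩ : T) = ⟨_, hn a⟩ * ⟨_, hn b⟩ := by
      apply Subtype.ext
      simp only [MulMemClass.coe_mul, map_mul]
      ring
    have h0 : χ (γ ^ n a * γ ^ n b) ≠ 0 := by rw [map_mul]; exact mul_ne_zero (hp _) (hp _)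
    apply mul_left_cancel₀ h0
    change χ (γ ^ n a * γ ^ n b) * f (a * b) = χ (γ ^ n a * γ ^ n b) * (f a * f b)
    rw [← key _ _ h3, e, map_mul, key _ _ (hn a), key _ _ (hn b), map_mul]
    ring

end ext

open Polynomial in
theorem thmC {F A Ag : Type*} [Field F] [IsAlgClosed F] (hF : LocFin F)
    [CommRing A] [IsDomain A] [Algebra F A] [Algebra.FiniteType F A]
    [CommRing Ag] [Algebra F Ag] [Algebra A Ag] [IsScalarTower F A Ag]
    (g : A) (hg : g ≠ 0) [IsLocalization.Away g Ag]
    (ψ : A →ₐ[F] Ag) (hψ : Function.Injective ψ) :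
    ∃ (χ : ℕ → Ag →ₐ[F] F) (M : ℕ), 0 < M ∧ (∀ i a, χ (i + 1) (algebraMap A Ag a) = χ i (ψ a)) ∧
      χ M = χ 0 := by
  classical
  let K := FractionRing A
  have hAK : Function.Injective (algebraMap A K) := IsFractionRing.injective A K
  have hunit : ∀ s : Submonoid.powers g, IsUnit (algebraMap A K s) := by
    rintro ⟨_, n, rfl⟩
    rw [map_pow]
    apply IsUnit.pow
    rw [isUnit_iff_ne_zero]
    simpa using hg
  let ι : Ag →+* K := IsLocalization.lift (M := Submonoid.powers g) hunit
  have hι : ∀ a, ι (algebraMap A Ag a) = algebraMap A K a := fun a => IsLocalization.lift_eq hunit a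
  have hιi : Function.Injective ι := by
    rw [injective_iff_map_eq_zero]
    intro b hb
    obtain ⟨⟨a, s⟩, has⟩ := IsLocalization.surj (Submonoid.powers g) b
    have h1 := congrArg ι has
    simp only at h1
    rw [map_mul, hb, zero_mul, hι] at h1
    have h2 : a = 0 := hAK (by rw [map_zero]; exact h1.symm)
    simp only [h2, map_zero] at has
    exact (IsLocalization.map_units Ag s).mul_left_eq_zero.1 has
  have hσ0 : Function.Injective (ι.comp ψ.toRingHom) := hιi.comp hψ
  let σ : K →+* K := IsFractionRing.lift hσ0
  have hσ : ∀ a, σ (algebraMap A K a) = ι (ψ a) := fun a => IsFractionRing.lift_algebraMap hσ0 a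
  have hFK : ∀ c : F, algebraMap F K c = algebraMap A K (algebraMap F A c) := fun c =>
    IsScalarTower.algebraMap_apply F A K c
  have hιF : ∀ c : F, ι (algebraMap F Ag c) = algebraMap F K c := by
    intro c
    rw [IsScalarTower.algebraMap_apply F A Ag, hι, hFK]
  have hσF : ∀ c : F, σ (algebraMap F K c) = algebraMap F K c := by
    intro c
    rw [hFK, hσ, AlgHom.commutes, hιF, hFK]
  obtain ⟨gens, hgens⟩ := (inferInstance : Algebra.FiniteType F A).out
  let E := K[X]
  let T : Subalgebra F E := Algebra.adjoin F
    (insert X ((fun a : A => (C (algebraMap A K a) * X : E)) '' (gens : Set A)))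
  have hXT : (X : E) ∈ T := Algebra.subset_adjoin (Set.mem_insert _ _)
  have hmem : ∀ a : A, ∃ d : ℕ, ∀ e ≥ d, (C (algebraMap A K a) * X ^ e : E) ∈ T := by
    intro a
    have ha : a ∈ Algebra.adjoin F (gens : Set A) := hgens ▸ Algebra.mem_top
    induction ha using Algebra.adjoin_induction with
    | mem x hx =>
      refine ⟨1, fun e he => ?_⟩
      obtain ⟨e, rfl⟩ : ∃ e', e = e' + 1 := ⟨e - 1, by omega⟩
      rw [pow_succ', ← mul_assoc]
      exact T.mul_mem (Algebra.subset_adjoin (Set.mem_insert_of_mem _ ⟨x, hx, rfl⟩))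
        (T.pow_mem hXT e)
    | algebraMap r =>
      refine ⟨0, fun e _ => ?_⟩
      refine T.mul_mem ?_ (T.pow_mem hXT e)
      rw [← hFK]
      exact T.algebraMap_mem r
    | add x z _ _ hx hz =>
      obtain ⟨d1, h1⟩ := hx
      obtain ⟨d2, h2⟩ := hz
      refine ⟨d1 + d2, fun e he => ?_⟩
      rw [map_add, map_add, add_mul]
      exact T.add_mem (h1 e (by omega)) (h2 e (by omega))
    | mul x z _ _ hx hz =>
      obtain ⟨d1, h1⟩ := hx
      obtain ⟨d2, h2⟩ := hz
      refine ⟨d1 + d2, fun e he => ?_⟩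
      obtain ⟨e, rfl⟩ : ∃ e', e = d1 + e' := ⟨e - d1, by omega⟩
      have : (C (algebraMap A K (x * z)) * X ^ (d1 + e) : E) =
          (C (algebraMap A K x) * X ^ d1) * (C (algebraMap A K z) * X ^ e) := by
        rw [map_mul, map_mul]; ring
      rw [this]
      exact T.mul_mem (h1 _ le_rfl) (h2 e (by omega))
  have hftT : Algebra.FiniteType F T := by
    rw [← Subalgebra.fg_iff_finiteType]
    refine ⟨insert X (gens.image (fun a : A => (C (algebraMap A K a) * X : E))), ?_⟩
    simp [T]
  -- common denominators
  obtain ⟨⟨_, n0, rfl⟩, hn0⟩ := IsLocalization.exist_integer_multiples_of_finset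
    (Submonoid.powers g) (gens.image ψ)
  have hden : ∀ a : gens, ∃ z : A, algebraMap A Ag z = algebraMap A Ag (g ^ n0) * ψ a := by
    intro a
    obtain ⟨z, hz⟩ := hn0 (ψ a) (Finset.mem_image_of_mem _ a.2)
    refine ⟨z, hz.trans ?_⟩
    rw [Algebra.smul_def]
  choose z hz using hden
  choose d hd using hmem
  obtain ⟨l, hl1, hl0, hlz⟩ : ∃ l : ℕ, 1 ≤ l ∧ d (g ^ n0) ≤ l ∧ ∀ a, d (z a) ≤ l := by
    refine ⟨1 + d (g ^ n0) + ∑ a, d (z a), by omega, by omega, fun a => ?_⟩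
    have := Finset.single_le_sum (f := fun a => d (z a)) (fun _ _ => Nat.zero_le _)
      (Finset.mem_univ a)
    omega
  let Q : E := C (algebraMap A K (g ^ n0)) * X ^ l
  have hgK : algebraMap A K (g ^ n0) ≠ 0 := by simpa using fun h => absurd h hg
  let ΦE0 : E →+* E := (compRingHom Q).comp (mapRingHom σ)
  have hΦE0C : ∀ c, ΦE0 (C c) = C (σ c) := fun c => by
    change ((C c).map σ).comp Q = C (σ c)
    rw [Polynomial.map_C, C_comp]
  let ΦE : E →ₐ[F] E := { ΦE0 with
    commutes' := by
      intro c
      change ΦE0 (C (algebraMap F K c)) = C (algebraMap F K c)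
      rw [hΦE0C, hσF] }
  have hΦEC : ∀ c, ΦE (C c) = C (σ c) := hΦE0C
  have hΦEX : ΦE X = Q := by
    change ((X : E).map σ).comp Q = Q
    rw [Polynomial.map_X, X_comp]
  have hΦEi : Function.Injective ΦE := by
    rw [injective_iff_map_eq_zero]
    intro P hP
    have h1 : (P.map σ).comp Q = 0 := hP
    rw [comp_eq_zero_iff] at h1
    rcases h1 with h1 | ⟨_, h1⟩
    · exact (Polynomial.map_eq_zero σ).1 h1
    · exfalso
      have h2 : Q.natDegree = l := natDegree_C_mul_X_pow l _ hgK
      rw [h1, natDegree_C] at h2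
      omega
  have hΦT : ∀ t : T, ΦE t ∈ T := by
    have h1 : T ≤ T.comap ΦE := by
      simp only [T]
      rw [Algebra.adjoin_le_iff]
      rintro x (rfl | ⟨a, ha, rfl⟩)
      · change ΦE X ∈ T
        rw [hΦEX]
        exact hd _ _ hl0
      · change ΦE (C (algebraMap A K a) * X) ∈ T
        rw [map_mul, hΦEC, hΦEX, hσ, ← mul_assoc, ← C_mul, ← hι (g ^ n0), ← map_mul, mul_comm,
          mul_comm (ψ a), ← hz ⟨a, ha⟩, hι, mul_comm]
        exact hd _ _ (hlz _)
    exact fun t => h1 t.2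
  let Φ : T →ₐ[F] T := AlgHom.codRestrict (ΦE.comp T.val) T hΦT
  have hΦv : ∀ t, ((Φ t : T) : E) = ΦE t := fun t => rfl
  have hΦi : Function.Injective Φ := fun a b hab => Subtype.ext (hΦEi (by
    rw [← hΦv, ← hΦv, hab]))
  let D := d g
  let γ : T := ⟨C (algebraMap A K g) * X ^ (D + 1), hd g _ (by omega)⟩
  have hgK1 : algebraMap A K g ≠ 0 := by simpa using hg
  have hγ0 : γ ≠ 0 := by
    intro h
    have : (C (algebraMap A K g) * X ^ (D + 1) : E) = 0 := congrArg Subtype.val h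
    exact mul_ne_zero (C_ne_zero.2 hgK1) (pow_ne_zero _ X_ne_zero) this
  obtain ⟨χ0, M, hM, hχ0, hper⟩ := thmB hF Φ hΦi γ hγ0
  let j : Ag →ₐ[F] E := { (C : K →+* E).comp ι with
    commutes' := by
      intro c
      change C (ι (algebraMap F Ag c)) = C (algebraMap F K c)
      rw [hιF] }
  have hjv : ∀ b, j b = C (ι b) := fun b => rfl
  have hj : ∀ b, ∃ n : ℕ, ((γ ^ n : T) : E) * j b ∈ T := by
    intro b
    obtain ⟨⟨a, ⟨_, m, rfl⟩⟩, has⟩ := IsLocalization.surj (Submonoid.powers g) b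
    refine ⟨m + d a, ?_⟩
    have h1 : ι b * algebraMap A K g ^ m = algebraMap A K a := by
      have := congrArg ι has
      simp only [map_mul, hι, map_pow] at this
      exact this
    have h2 : ((γ ^ (m + d a) : T) : E) * j b =
        (C (algebraMap A K a) * X ^ ((D + 1) * m + d a)) * (C (algebraMap A K g) * X ^ D) ^ d a := by
      rw [hjv, ← h1]
      simp only [SubmonoidClass.coe_pow, γ, map_mul, map_pow]
      ring
    rw [h2]
    exact T.mul_mem (hd a _ (by omega)) (T.pow_mem (hd g _ le_rfl) _)
  let χT : ℕ → T →ₐ[F] F := fun i => χ0.comp (Φ ^ i)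
  have hχT : ∀ i t, χT i t = χ0 (Φ^[i] t) := by
    intro i t
    simp only [χT, AlgHom.comp_apply, AlgHom.coe_pow]
  have hχTs : ∀ i t, χT (i + 1) t = χT i (Φ t) := by
    intro i t
    rw [hχT, hχT, Function.iterate_succ_apply]
  have hχγ : ∀ i, χT i γ ≠ 0 := fun i => by rw [hχT]; exact hχ0 i
  choose χ hχ using fun i => ext_hom T j γ hj (χT i) (hχγ i)
  refine ⟨χ, M, hM, ?_, ?_⟩
  · intro i a
    obtain ⟨n, hn⟩ := hj (algebraMap A Ag a)
    have h0 : χT (i + 1) (γ ^ n) ≠ 0 := by rw [map_pow]; exact pow_ne_zero _ (hχγ _)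
    apply mul_left_cancel₀ h0
    rw [← hχ (i + 1) _ _ hn, hχTs, hχTs]
    have e : ((Φ (γ ^ n) : T) : E) * j (ψ a) = ((Φ ⟨_, hn⟩ : T) : E) := by
      rw [hΦv, hΦv, map_mul, hjv, hjv, hΦEC, hι, hσ]
    have hm : ((Φ (γ ^ n) : T) : E) * j (ψ a) ∈ T := e ▸ (Φ ⟨_, hn⟩).2
    rw [← hχ i _ _ hm]
    congr 1
    exact Subtype.ext e.symm
  · have hT : χT M = χT 0 := by
      ext t
      rw [hχT, hper, hχT]; rfl
    ext b
    obtain ⟨n, hn⟩ := hj b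
    have h0 : χT 0 (γ ^ n) ≠ 0 := by rw [map_pow]; exact pow_ne_zero _ (hχγ _)
    apply mul_left_cancel₀ h0
    rw [← hχ 0 _ _ hn, ← hT, ← hχ M _ _ hn]

end PerDense

namespace PerDense

lemma thmC_cat {F : Type u} [Field F] [IsAlgClosed F] (hF : LocFin F)
    (A B : CommRingCat.{u}) [IsDomain A] (α : CommRingCat.of F ⟶ A) (hα : α.hom.FiniteType)
    (r : A ⟶ B) (g : A) (hg : g ≠ 0)
    (hloc : letI := r.hom.toAlgebra; IsLocalization.Away g B)
    (ψ : A ⟶ B) (hψα : α ≫ ψ = α ≫ r) (hψ : Function.Injective ψ.hom) :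
    ∃ (χ : ℕ → (B ⟶ CommRingCat.of F)) (M : ℕ), 0 < M ∧
      (∀ i, r ≫ χ (i + 1) = ψ ≫ χ i) ∧ χ M = χ 0 ∧ α ≫ r ≫ χ 0 = 𝟙 _ := by
  letI : Algebra F A := α.hom.toAlgebra
  letI : Algebra A B := r.hom.toAlgebra
  letI : Algebra F B := (α ≫ r).hom.toAlgebra
  have : IsScalarTower F A B := IsScalarTower.of_algebraMap_eq (fun _ => rfl)
  have : Algebra.FiniteType F A := hα
  have : IsLocalization.Away g B := hloc
  let ψ' : A →ₐ[F] B := { ψ.hom with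
    commutes' := fun c => congrArg (fun h : CommRingCat.of F ⟶ B => h.hom c) hψα }
  obtain ⟨χ, M, hM, h1, h2⟩ := thmC hF g hg ψ' hψ
  refine ⟨fun i => CommRingCat.ofHom (χ i).toRingHom, M, hM, ?_, ?_, ?_⟩
  · intro i
    ext a
    exact h1 i a
  · simp only [h2]
  · ext c
    exact (χ 0).commutes c

lemma top_part {X : Type*} [TopologicalSpace X] [QuasiSober X] [T0Space X]
    (hfin : (irreducibleComponents X).Finite) (f : X → X) (hf : Continuous f)
    (hs : Function.Surjective f) (W : Set X) (hW : IsOpen W) (hne : W.Nonempty) :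
    ∃ (η : X) (m : ℕ) (V : Set X), 0 < m ∧ f^[m] η = η ∧ IsOpen V ∧ η ∈ V ∧ V ⊆ W ∧
      ∀ y ∈ V, η ⤳ y := by
  let G : Set X := {x | closure {x} ∈ irreducibleComponents X}
  have hG : ∀ x ∈ G, ∀ y, y ⤳ x → y = x := by
    intro x hx y hy
    have h1 : closure {x} ⊆ closure {y} := hy.closure_subset
    have h2 : closure {y} ⊆ closure {x} := hx.2 (isIrreducible_singleton.closure) h1
    exact (hy.antisymm (specializes_iff_closure_subset.2 h2)).eq
  have hGf : G.Finite := by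
    refine Set.Finite.of_finite_image (f := fun x => closure {x})
      (hfin.subset (by rintro _ ⟨x, hx, rfl⟩; exact hx)) ?_
    intro x hx y hy (hxy : closure {x} = closure {y})
    exact hG y hy x (specializes_iff_closure_subset.2 hxy.ge)
  have hex : ∀ x, ∃ ξ ∈ G, ξ ⤳ x := by
    intro x
    have hi := isIrreducible_irreducibleComponent (x := x)
    have hc := hi.closure_genericPoint isClosed_irreducibleComponent
    refine ⟨hi.genericPoint, ?_, ?_⟩
    · change closure {hi.genericPoint} ∈ irreducibleComponents X
      rw [hc]
      exact irreducibleComponent_mem_irreducibleComponents x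
    · rw [specializes_iff_mem_closure, hc]
      exact mem_irreducibleComponent
  have hpre : ∀ η : G, ∃ ξ : G, f ξ = η := by
    rintro ⟨η, hη⟩
    obtain ⟨x, rfl⟩ := hs η
    obtain ⟨ξ, hξ, h⟩ := hex x
    exact ⟨⟨ξ, hξ⟩, hG _ hη _ (h.map hf)⟩
  choose s hs' using hpre
  have hsi : Function.Injective s := fun a b h => Subtype.ext (by rw [← hs' a, ← hs' b, h])
  obtain ⟨w, hw⟩ := hne
  obtain ⟨η, hη, hηw⟩ := hex w
  have hηW : η ∈ W := hηw.mem_open hW hw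
  have : Finite G := hGf
  obtain ⟨m, hm, hper⟩ := hsi.mem_periodicPts ⟨η, hη⟩
  have hit : ∀ (n : ℕ) (a : G), f^[n] (s^[n] a : G) = a := by
    intro n
    induction n with
    | zero => intro a; rfl
    | succ n ih =>
      intro a
      rw [Function.iterate_succ_apply, Function.iterate_succ_apply', hs', ih]
  refine ⟨η, m, W ∩ (⋃ ξ ∈ G \ {η}, closure {ξ})ᶜ, hm, ?_, ?_, ?_, Set.inter_subset_left, ?_⟩
  · have := hit m ⟨η, hη⟩
    rwa [hper.eq] at this
  · refine hW.inter (Set.Finite.isClosed_biUnion (hGf.subset Set.sdiff_subset)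
      (fun _ _ => isClosed_closure)).isOpen_compl
  · refine ⟨hηW, ?_⟩
    simp only [Set.mem_compl_iff, Set.mem_iUnion, not_exists]
    intro ξ hξ h
    exact hξ.2 (hG η hη ξ (specializes_iff_mem_closure.2 h))
  · rintro y ⟨_, hy⟩
    obtain ⟨ξ, hξ, h⟩ := hex y
    by_cases e : ξ = η
    · exact e ▸ h
    · refine absurd ?_ hy
      simp only [Set.mem_iUnion]
      exact ⟨ξ, ⟨hξ, e⟩, specializes_iff_mem_closure.1 h⟩

lemma morphIter_base {X : Scheme.{u}} (φ : X ⟶ X) (n : ℕ) (x : X) :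
    (morphIter φ n).base x = φ.base^[n] x := by
  induction n with
  | zero => rfl
  | succ n ih =>
    rw [Function.iterate_succ_apply', ← ih]
    rfl

lemma morphIter_over {X S : Scheme.{u}} (φ : X ⟶ X) (s : X ⟶ S) (h : φ ≫ s = s) (n : ℕ) :
    morphIter φ n ≫ s = s := by
  induction n with
  | zero => exact Category.id_comp _
  | succ n ih =>
    change (morphIter φ n ≫ φ) ≫ s = s
    rw [Category.assoc, h, ih]

lemma geom {F : Type u} [Field F] [IsAlgClosed F] (hF : LocFin F)
    {X : Scheme.{u}} (sX : X ⟶ Spec (CommRingCat.of F)) [IsReduced X]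
    [LocallyOfFiniteType sX] (f : X ⟶ X) (hf : f ≫ sX = sX) (η : X) (hη : f.base η = η)
    (V : X.Opens) (hηV : η ∈ V) (hV : ∀ y ∈ V, η ⤳ y) :
    ∃ x ∈ V, (∃ M : ℕ, 0 < M ∧ f.base^[M] x = x) ∧ IsClosed ({x} : Set X) := by
  obtain ⟨_, ⟨U, hU, rfl⟩, hηU, hUV⟩ := X.isBasis_affineOpens.exists_subset_of_mem_open hηV V.isOpen
  have hU : IsAffineOpen U := hU
  have hηU : η ∈ U := hηU
  have hUV : U ≤ V := hUV
  have hmem : ∀ a : Γ(X, U), a ≠ 0 → η ∈ X.basicOpen a := by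
    intro a ha
    have h1 : X.basicOpen a ≠ ⊥ := by rwa [Ne, basicOpen_eq_bot_iff]
    obtain ⟨y, hy⟩ := (TopologicalSpace.Opens.ne_bot_iff_nonempty _).1 h1
    exact (hV y (hUV (X.basicOpen_le a hy))).mem_open (X.basicOpen a).isOpen hy
  have : Nonempty U := ⟨⟨η, hηU⟩⟩
  have : IsDomain Γ(X, U) := by
    have : NoZeroDivisors Γ(X, U) := by
      refine ⟨fun {a b} hab => ?_⟩
      by_contra! h
      have h1 : η ∈ X.basicOpen (a * b) := by
        rw [Scheme.basicOpen_mul]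
        exact ⟨hmem a h.1, hmem b h.2⟩
      rw [hab, Scheme.basicOpen_zero] at h1
      exact h1
    exact NoZeroDivisors.to_isDomain _
  obtain ⟨g, hgle, hηg⟩ := hU.exists_basicOpen_le (V := U ⊓ f ⁻¹ᵁ U)
    ⟨η, hηU, by change f.base η ∈ U; rwa [hη]⟩ hηU
  have hg0 : g ≠ 0 := by
    rintro rfl
    rw [Scheme.basicOpen_zero] at hηg
    exact hηg
  have hD : IsAffineOpen (X.basicOpen g) := hU.basicOpen g
  obtain ⟨α, hα⟩ : ∃ α, Spec.map α = hU.fromSpec ≫ sX := ⟨_, Spec.map_preimage _⟩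
  have hαf : α.hom.FiniteType := by
    have : LocallyOfFiniteType (Spec.map α) := by rw [hα]; infer_instance
    exact HasRingHomProperty.Spec_iff.mp this
  let i : op U ⟶ op (X.basicOpen g) := (homOfLE (X.basicOpen_le g)).op
  let r : Γ(X, U) ⟶ Γ(X, X.basicOpen g) := X.presheaf.map i
  let ψ : Γ(X, U) ⟶ Γ(X, X.basicOpen g) :=
    f.appLE U (X.basicOpen g) (hgle.trans inf_le_right)
  have hr : Spec.map r ≫ hU.fromSpec = hD.fromSpec := hU.map_fromSpec hD i
  have hψ : Spec.map ψ ≫ hU.fromSpec = hD.fromSpec ≫ f := IsAffineOpen.SpecMap_appLE_fromSpec ..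
  have hcomp : α ≫ ψ = α ≫ r := by
    apply Spec.map_injective
    rw [Spec.map_comp, Spec.map_comp, hα, reassoc_of% hψ, reassoc_of% hr, hf]
  have hinj : Function.Injective ψ.hom := by
    rw [injective_iff_map_eq_zero]
    intro a ha
    by_contra hne
    have h1 : η ∈ X.basicOpen (ψ.hom a) := by
      have : X.basicOpen (ψ.hom a) = X.basicOpen g ⊓ f ⁻¹ᵁ (X.basicOpen a) := by
        change X.basicOpen (f.appLE U (X.basicOpen g) _ a) = _
        rw [Scheme.basicOpen_appLE]
      rw [this]
      refine ⟨hηg, ?_⟩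
      change f.base η ∈ X.basicOpen a
      rw [hη]
      exact hmem a hne
    rw [ha, Scheme.basicOpen_zero] at h1
    exact h1
  obtain ⟨χ, M, hM, h1, h2, h3⟩ := thmC_cat hF _ _ α hαf r g hg0
    (hU.isLocalization_basicOpen g) ψ hcomp hinj
  let P : ℕ → (Spec (CommRingCat.of F) ⟶ X) := fun n => Spec.map (χ n) ≫ hD.fromSpec
  have hP : ∀ n, P n ≫ f = P (n + 1) := by
    intro n
    simp only [P]
    rw [Category.assoc, ← hψ, ← Spec.map_comp_assoc, ← h1, Spec.map_comp_assoc, hr]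
  have hP0 : P 0 ≫ sX = 𝟙 _ := by
    simp only [P]
    rw [Category.assoc, ← hr, Category.assoc, ← hα, ← Spec.map_comp, ← Spec.map_comp,
      Category.assoc, h3, Spec.map_id]
  let pt : Spec (CommRingCat.of F) := (⊥ : PrimeSpectrum F)
  have : Subsingleton (Spec (CommRingCat.of F)) := inferInstanceAs (Subsingleton (PrimeSpectrum F))
  have := isClosedImmersion_of_comp_eq_id sX (P 0) hP0
  have hit : ∀ n, f.base^[n] ((P 0).base pt) = (P n).base pt := by
    intro n
    induction n with
    | zero => rfl
    | succ n ih =>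
      rw [Function.iterate_succ_apply', ih, ← hP]
      rfl
  refine ⟨(P 0).base pt, ?_, ⟨M, hM, ?_⟩, ?_⟩
  · apply hUV
    apply X.basicOpen_le g
    have : hD.fromSpec.base ((Spec.map (χ 0)).base pt) ∈ Set.range hD.fromSpec.base := ⟨_, rfl⟩
    have h4 := hD.range_fromSpec
    exact h4.le this
  · rw [hit]
    have : P M = P 0 := by simp only [P, h2]
    rw [this]
  · have h5 : ({(P 0).base pt} : Set X) = Set.range (P 0).base := by
      ext y
      constructor
      · rintro rfl; exact ⟨_, rfl⟩
      · rintro ⟨z, rfl⟩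
        rw [Subsingleton.elim z pt]; rfl
    rw [h5]
    exact (P 0).isClosedEmbedding.isClosed_range

end PerDense

/-- Let `F` be the algebraic closure of a finite field (an algebraically
closed field of characteristic `p` which is algebraic over its prime field), `X` an
algebraic variety over `F` and `φ : X → X` a finite surjective morphism. Then the set of
points of `X(F)` (= closed points of `X`) that are periodic for `φ` is Zariski dense
in `X`. -/
theorem stmt_17 (p : ℕ) (hp : p.Prime) (F : Type u) [Field F] [IsAlgClosed F] [CharP F p]
    (halg : letI := ZMod.algebra F p; Algebra.IsAlgebraic (ZMod p) F)
    {X : Scheme.{u}} (sX : X ⟶ Spec (CommRingCat.of F)) (hred : IsReduced X)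
    (hsep : IsSeparated sX) (hft : LocallyOfFiniteType sX) (hqc : CompactSpace X)
    (φ : X ⟶ X) (hφ : φ ≫ sX = sX) (hfin : IsFinite φ)
    (hsurj : Function.Surjective φ.base) :
    Dense {x : X | (∃ m : ℕ, 0 < m ∧ (morphIter φ m).base x = x) ∧
      IsClosed ({x} : Set X)} := by
  rw [dense_iff_inter_open]
  intro W hW hne
  have : IsLocallyNoetherian X := LocallyOfFiniteType.isLocallyNoetherian sX
  have : IsNoetherian X := {}
  obtain ⟨η, m, V, hm, hη, hV, hηV, hVW, hsp⟩ := PerDense.top_part (X := X)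
    TopologicalSpace.NoetherianSpace.finite_irreducibleComponents φ.base φ.continuous hsurj W hW hne
  obtain ⟨x, hxV, ⟨M, hM, hx⟩, hcl⟩ := PerDense.geom (PerDense.locFin_of p hp F halg) sX (morphIter φ m)
    (PerDense.morphIter_over φ sX hφ m) η (by rw [PerDense.morphIter_base]; exact hη) ⟨V, hV⟩ hηV hsp
  refine ⟨x, hVW hxV, ⟨m * M, Nat.mul_pos hm hM, ?_⟩, hcl⟩
  have hfun : ((morphIter φ m).base : X → X) = φ.base^[m] := funext (PerDense.morphIter_base φ m)
  rw [PerDense.morphIter_base, Function.iterate_mul, ← hfun]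
  exact hx
end
end
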